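/- arXiv:1710.07722 — 5 statements merged into one kernel-verified Lean document; each statement's English description precedes it below -/
import Mathlib

section
/- Let P ⊆ ℝ^k be a polytope, and for every nonempty face σ of P (including P itself) choose a point y_σ ∈ σ and a closed set A_σ ⊆ P. If σ ⊆ ⋃_{τ ⊆ σ, τ a nonempty face} A_τ for every nonempty face σ of P, then there exist nonempty faces σ_1, …, σ_m of P such that y_P ∈ conv{y_{σ_1}, …, y_{σ_m}} and ⋂_{i=1}^m A_{σ_i} ≠ ∅. -/
open Filter Finset Topology

/-- If `f` identifies exactly one pair of points of `A`, counted by cardinality, then there are exactly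
two points of `A` whose removal does not change the image. -/
theorem Finset.card_filter_image_erase_eq {α β : Type*} [DecidableEq α] [DecidableEq β]
    (f : α → β) (A : Finset α) (h : #A = #(A.image f) + 1) :
    #{x ∈ A | (A.erase x).image f = A.image f} = 2 := by
  obtain ⟨a, ha, b, hb, hab, hfab⟩ :=
    exists_ne_map_eq_of_card_lt_of_maps_to (s := A) (t := A.image f) (f := f) (by omega)
      (fun x hx => mem_image_of_mem f hx)
  have key : ∀ (A : Finset α) {a b : α}, b ∈ A → a ≠ b → f a = f b →
      (A.erase a).image f = A.image f := by
    intro A a b hb hab hfab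
    refine subset_antisymm (image_subset_image (erase_subset _ _)) fun y hy => ?_
    obtain ⟨x, hx, rfl⟩ := mem_image.1 hy
    by_cases hxa : x = a
    · exact mem_image.2 ⟨b, mem_erase.2 ⟨hab.symm, hb⟩, by rw [hxa, hfab]⟩
    · exact mem_image_of_mem f (mem_erase.2 ⟨hxa, hx⟩)
  suffices {x ∈ A | (A.erase x).image f = A.image f} = {a, b} by rw [this, card_pair hab]
  ext x
  simp only [mem_filter, mem_insert, mem_singleton]
  constructor
  · rintro ⟨hx, hxA⟩
    by_contra! hne
    have h1 := key (A.erase x) (a := a) (b := b) (mem_erase.2 ⟨hne.2.symm, hb⟩) hab hfab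
    have h2 : #(((A.erase x).erase a).image f) ≤ #((A.erase x).erase a) := card_image_le
    have h3 : a ∈ A.erase x := mem_erase.2 ⟨hne.1.symm, ha⟩
    rw [h1, hxA, card_erase_of_mem h3, card_erase_of_mem hx] at h2
    have h4 := card_pos.2 (⟨f a, mem_image_of_mem f ha⟩ : (A.image f).Nonempty)
    omega
  · rintro (rfl | rfl)
    · exact ⟨ha, key A hb hab hfab⟩
    · exact ⟨hb, key A ha hab.symm hfab.symm⟩

/-- A finset `S` is a cell for the rankings `r i` if no point beats, in every ranking, the
lowest-ranked member of `S`. -/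
def IsRankCell {I X : Type*} (r : I → X → ℕ) (S : Finset X) : Prop :=
  ∀ x, ∃ i, ∀ y ∈ S, r i x ≤ r i y

namespace IsRankCell

variable {I X : Type*} {r : I → X → ℕ} {S T : Finset X}

theorem mono (hT : IsRankCell r T) (h : S ⊆ T) : IsRankCell r S := fun x =>
  (hT x).imp fun _ hi y hy => hi y (h hy)

theorem exists_eq_of_isMin (hr : ∀ i, Function.Injective (r i)) (hS : IsRankCell r S) {m : I → X}
    (hmS : ∀ i, m i ∈ S) (hm : ∀ i, ∀ y ∈ S, r i (m i) ≤ r i y) {x : X} (hx : x ∈ S) :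
    ∃ i, m i = x := by
  obtain ⟨i, hi⟩ := hS x
  exact ⟨i, hr i (le_antisymm (hm i x hx) (hi _ (hmS i)))⟩

variable [Fintype I] [Fintype X] [DecidableEq I] [DecidableEq X]

open Classical in
/-- A cell of codimension one containing a point `x₀` ranked below `s i` in every ranking `j ≠ i`
extends to a full cell in exactly two ways. -/
theorem card_extensions_eq_two (hr : ∀ i, Function.Injective (r i)) (hS : IsRankCell r S)
    (hcard : Fintype.card I = #S + 1) {x₀ : X} (hx₀ : x₀ ∈ S) {s : I → X}
    (hs : ∀ i j, j ≠ i → r j x₀ < r j (s i)) :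
    #{x | x ∉ S ∧ IsRankCell r (insert x S)} = 2 := by
  choose m hmS hm using fun i => exists_min_image S (r i) ⟨x₀, hx₀⟩
  have himg : univ.image m = S := by
    ext x
    simp only [mem_image, mem_univ, true_and]
    exact ⟨fun ⟨i, hi⟩ => hi ▸ hmS i, fun hx => hS.exists_eq_of_isMin hr hmS hm hx⟩
  have key := card_filter_image_erase_eq m univ (by rw [himg, card_univ, hcard])
  rw [himg] at key
  rw [← key]
  have hmax : ∀ i, ∃ x, (∀ j, j ≠ i → r j (m j) < r j x) ∧
      ∀ z, (∀ j, j ≠ i → r j (m j) < r j z) → r i z ≤ r i x := by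
    intro i
    obtain ⟨x, hx, hxm⟩ := exists_max_image ({x | ∀ j, j ≠ i → r j (m j) < r j x} : Finset X) (r i)
      ⟨s i, by simpa using fun j hj => (hm j x₀ hx₀).trans_lt (hs i j hj)⟩
    exact ⟨x, by simpa using hx, fun z hz => hxm z (by simpa using hz)⟩
  choose g hg hgmax using hmax
  symm
  refine card_bij (fun i _ => g i) ?_ ?_ ?_
  · intro i hi
    simp only [mem_filter, mem_univ, true_and] at hi ⊢
    refine ⟨fun hgS => ?_, fun x => ?_⟩
    · rw [← hi] at hgS
      obtain ⟨j, hj, hji⟩ := mem_image.1 hgS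
      exact (hg i j (ne_of_mem_erase hj)).ne (by rw [hji])
    · by_cases hx : ∀ j, j ≠ i → r j (m j) < r j x
      · refine ⟨i, ?_⟩
        obtain ⟨j, hj⟩ := hS x
        have hji : j = i := by
          by_contra hji
          exact absurd (hj _ (hmS j)) (not_le.2 (hx j hji))
        subst hji
        intro y hy
        rcases mem_insert.1 hy with rfl | hy
        · exact hgmax j x hx
        · exact hj y hy
      · push Not at hx
        obtain ⟨j, hji, hj⟩ := hx
        refine ⟨j, fun y hy => ?_⟩
        rcases mem_insert.1 hy with rfl | hy
        · exact hj.trans (hg i j hji).le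
        · exact hj.trans (hm j y hy)
  · intro i hi i' hi' (h : g i = g i')
    by_contra hne
    obtain ⟨j, hj⟩ := hS (g i)
    refine absurd (hj _ (hmS j)) (not_le.2 ?_)
    by_cases hji : j = i
    · rw [h]
      exact hg i' j (hji ▸ hne)
    · exact hg i j hji
  · intro x hx
    simp only [mem_filter, mem_univ, true_and] at hx
    obtain ⟨hxS, hcell⟩ := hx
    choose m' hm'S hm' using fun i => exists_min_image (insert x S) (r i) ⟨x, mem_insert_self x S⟩
    obtain ⟨i, hi⟩ := hcell.exists_eq_of_isMin hr hm'S hm' (mem_insert_self x S)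
    -- the minimisers of `insert x S` other than `x` are minimisers of `S`
    have hmm : ∀ j, m' j ≠ x → m' j = m j := fun j hj =>
      hr j (le_antisymm (hm' j _ (mem_insert_of_mem (hmS j)))
        (hm j _ (mem_of_mem_insert_of_ne (hm'S j) hj)))
    have himg' : (univ.erase i).image m = S := by
      ext y
      constructor
      · intro hy
        obtain ⟨j, -, rfl⟩ := mem_image.1 hy
        exact hmS j
      · intro hy
        obtain ⟨j, rfl⟩ := hcell.exists_eq_of_isMin hr hm'S hm' (mem_insert_of_mem hy)
        have hjx : m' j ≠ x := fun h => hxS (h ▸ hy)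
        exact mem_image.2 ⟨j, mem_erase.2 ⟨fun h => hjx (h ▸ hi), mem_univ j⟩, (hmm j hjx).symm⟩
    have hlt : ∀ j, j ≠ i → r j (m j) < r j x := by
      intro j hj
      have hcj : #(univ.erase i) = #S := by rw [card_erase_of_mem (mem_univ i), card_univ]; omega
      refine lt_of_le_of_ne ?_ fun h => hxS (hr j h ▸ hmS j)
      by_contra! hlt'
      -- otherwise `x` minimises the ranking `j` too, and `S` has too few minimisers
      have hj' : m' j = x := by
        by_contra hne
        have := hm' j x (mem_insert_self x S)
        rw [hmm j hne] at this
        omega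
      have hsub : S ⊆ ((univ.erase i).erase j).image m := by
        intro y hy
        obtain ⟨l, rfl⟩ := hcell.exists_eq_of_isMin hr hm'S hm' (mem_insert_of_mem hy)
        have hlx : m' l ≠ x := fun h => hxS (h ▸ hy)
        exact mem_image.2 ⟨l, mem_erase.2 ⟨fun h => hlx (h ▸ hj'),
          mem_erase.2 ⟨fun h => hlx (h ▸ hi), mem_univ l⟩⟩, (hmm l hlx).symm⟩
      have h1 := (card_le_card hsub).trans card_image_le
      have hjm : j ∈ univ.erase i := mem_erase.2 ⟨hj, mem_univ j⟩
      have h2 := card_pos.2 ⟨j, hjm⟩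
      rw [card_erase_of_mem hjm] at h1
      omega
    refine ⟨i, by simpa using himg', hr i (le_antisymm ?_ ?_)⟩
    · obtain ⟨j, hj⟩ := hcell (g i)
      have hji : j = i := by
        by_contra hji
        exact absurd (hj _ (mem_insert_of_mem (hmS j))) (not_le.2 (hg i j hji))
      subst hji
      exact hj x (mem_insert_self x S)
    · exact hgmax i x hlt

open Classical in
/-- The cell consisting of all bottom elements `s i`, `i ≠ i₀`, extends to a full cell in exactly
one way. -/
theorem card_extensions_bot_eq_one (hr : ∀ i, Function.Injective (r i)) {s : I → X}
    (hbot : ∀ i x, x ≠ s i → r i (s i) < r i x)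
    (htop : ∀ i j x, j ≠ i → x ∉ Set.range s → r i x < r i (s j))
    {x₀ : X} (hx₀ : x₀ ∉ Set.range s) (i₀ : I) :
    #{x | x ∉ (univ.erase i₀).image s ∧ IsRankCell r (insert x ((univ.erase i₀).image s))} = 1 := by
  have hle : ∀ i x, r i (s i) ≤ r i x := fun i x => by
    by_cases h : x = s i
    · rw [h]
    · exact (hbot i x h).le
  obtain ⟨a, ha, hmax⟩ := exists_max_image ({x | x ∉ Set.range s} : Finset X) (r i₀)
    ⟨x₀, by simpa using hx₀⟩
  replace ha : a ∉ Set.range s := (mem_filter.1 ha).2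
  have hforce : ∀ {x}, IsRankCell r (insert x ((univ.erase i₀).image s)) →
      ∀ z, z ∉ Set.range s → r i₀ z ≤ r i₀ x := by
    intro x hx z hz
    obtain ⟨i, hi⟩ := hx z
    by_cases h : i = i₀
    · exact h ▸ hi x (mem_insert_self _ _)
    · refine absurd (hi (s i) (mem_insert_of_mem (mem_image_of_mem s (mem_erase.2 ⟨h, mem_univ i⟩))))
        (not_le.2 (hbot i z fun h => hz ⟨i, h.symm⟩))
  rw [card_eq_one]
  refine ⟨a, ?_⟩
  ext x
  simp only [mem_filter, mem_univ, true_and, mem_singleton]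
  constructor
  · rintro ⟨hxS, hcell⟩
    have hxr : x ∉ Set.range s := by
      rintro ⟨i, rfl⟩
      by_cases h : i = i₀
      · subst h
        exact absurd (hforce hcell x₀ hx₀) (not_le.2 (hbot i x₀ fun h => hx₀ ⟨i, h.symm⟩))
      · exact hxS (mem_image_of_mem s (mem_erase.2 ⟨h, mem_univ i⟩))
    exact hr i₀ (le_antisymm (hmax x (by simpa using hxr)) (hforce hcell a ha))
  · rintro rfl
    refine ⟨fun h => ?_, fun z => ?_⟩
    · obtain ⟨i, -, rfl⟩ := mem_image.1 h
      exact ha ⟨i, rfl⟩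
    · by_cases hz : z ∈ Set.range s
      · obtain ⟨i, rfl⟩ := hz
        exact ⟨i, fun y _ => hle i y⟩
      · refine ⟨i₀, fun y hy => ?_⟩
        rcases mem_insert.1 hy with rfl | hy
        · exact hmax z (by simpa using hz)
        · obtain ⟨j, hj, rfl⟩ := mem_image.1 hy
          exact (htop i₀ j z (ne_of_mem_erase hj) hz).le

open Classical in
/-- **Scarf's lemma**: every colouring which is the identity on the bottom elements admits a
multicoloured cell. -/
theorem exists_image_eq_univ [Nonempty I] (hr : ∀ i, Function.Injective (r i)) {s : I → X}
    (hbot : ∀ i x, x ≠ s i → r i (s i) < r i x)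
    (htop : ∀ i j x, j ≠ i → x ∉ Set.range s → r i x < r i (s j))
    {x₀ : X} (hx₀ : x₀ ∉ Set.range s) {c : X → I} (hc : ∀ i, c (s i) = i) :
    ∃ S : Finset X, IsRankCell r S ∧ S.image c = univ := by
  by_contra! hno
  obtain ⟨i₀⟩ := ‹Nonempty I›
  set n := Fintype.card I with hn
  have hnpos : 0 < n := Fintype.card_pos_iff.2 ⟨i₀⟩
  have hce : #(univ.erase i₀) + 1 = n := by
    rw [card_erase_of_mem (mem_univ i₀), card_univ]; omega
  let doors : Finset (Finset X) := {S | #S + 1 = n ∧ S.image c = univ.erase i₀}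
  let rooms : Finset (Finset X) := {R | #R = n ∧ IsRankCell r R}
  have hswap : ∑ S ∈ doors, #{x | x ∉ S ∧ IsRankCell r (insert x S)} =
      ∑ R ∈ rooms, #{x ∈ R | (R.erase x).image c = univ.erase i₀} := by
    rw [← card_sigma, ← card_sigma]
    refine card_bij (fun p _ => ⟨insert p.2 p.1, p.2⟩) ?_ ?_ ?_
    · rintro ⟨S, x⟩ h
      simp only [doors, rooms, mem_sigma, mem_filter, mem_univ, true_and] at h ⊢
      obtain ⟨⟨h1, h2⟩, h3, h4⟩ := h
      exact ⟨⟨by rw [card_insert_of_notMem h3, h1], h4⟩, mem_insert_self _ _,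
        by rw [erase_insert h3, h2]⟩
    · rintro ⟨S, x⟩ h ⟨S', x'⟩ h' heq
      simp only [doors, mem_sigma, mem_filter, mem_univ, true_and] at h h'
      simp only [Sigma.mk.injEq, heq_eq_eq] at heq ⊢
      obtain ⟨h1, rfl⟩ := heq
      exact ⟨by rw [← erase_insert h.2.1, h1, erase_insert h'.2.1], rfl⟩
    · rintro ⟨R, x⟩ h
      simp only [rooms, mem_sigma, mem_filter, mem_univ, true_and] at h
      obtain ⟨⟨h1, h2⟩, h3, h4⟩ := h
      refine ⟨⟨R.erase x, x⟩, ?_, by simp [insert_erase h3]⟩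
      simp only [doors, mem_sigma, mem_filter, mem_univ, true_and]
      exact ⟨⟨by rw [card_erase_of_mem h3]; omega, h4⟩, notMem_erase _ _,
        by rwa [insert_erase h3]⟩
  have hR : Even (∑ R ∈ rooms, #{x ∈ R | (R.erase x).image c = univ.erase i₀}) := by
    refine even_sum _ fun R hR => ?_
    obtain ⟨hRc, hcell⟩ := (mem_filter.1 hR).2
    by_cases h : R.image c = univ.erase i₀
    · rw [← h, card_filter_image_erase_eq c R (by rw [h]; omega)]
      exact even_two
    · suffices #{x ∈ R | (R.erase x).image c = univ.erase i₀} = 0 by simp [this]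
      rw [card_eq_zero, filter_eq_empty_iff]
      intro x hx hxe
      have h1 : R.image c = insert (c x) (univ.erase i₀) := by
        rw [← hxe, ← image_insert, insert_erase hx]
      by_cases h2 : c x = i₀
      · exact hno R hcell (by rw [h1, h2, insert_erase (mem_univ i₀)])
      · exact h (by rw [h1, insert_eq_of_mem (mem_erase.2 ⟨h2, mem_univ _⟩)])
  have hsinj : Function.Injective s := fun i j h => by rw [← hc i, h, hc j]
  set B : Finset X := (univ.erase i₀).image s with hB
  have hBd : B ∈ doors := by
    simp only [doors, mem_filter, mem_univ, true_and]
    refine ⟨by rw [hB, card_image_of_injective _ hsinj, hce], ?_⟩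
    rw [hB, image_image, show c ∘ s = id from funext hc, image_id]
  rw [← hswap, ← add_sum_erase _ _ hBd, card_extensions_bot_eq_one hr hbot htop hx₀ i₀] at hR
  have hD : Even (∑ S ∈ doors.erase B, #{x | x ∉ S ∧ IsRankCell r (insert x S)}) := by
    refine even_sum _ fun S hS => ?_
    obtain ⟨hSB, hS⟩ := mem_erase.1 hS
    obtain ⟨hcard, himg⟩ := (mem_filter.1 hS).2
    by_cases hcell : IsRankCell r S
    · have hreal : ∃ x ∈ S, x ∉ Set.range s := by
        by_contra! h
        refine hSB (eq_of_subset_of_card_le (fun x hx => ?_) ?_)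
        · obtain ⟨i, rfl⟩ := h x hx
          have := mem_image_of_mem c hx
          rw [himg, hc] at this
          exact mem_image_of_mem s this
        · rw [hB, card_image_of_injective _ hsinj]; omega
      obtain ⟨x, hxS, hx⟩ := hreal
      rw [card_extensions_eq_two hr hcell hcard.symm hxS
        fun i j hj => htop j i x hj.symm hx]
      exact even_two
    · suffices #{x | x ∉ S ∧ IsRankCell r (insert x S)} = 0 by simp [this]
      rw [card_eq_zero, filter_eq_empty_iff]
      exact fun x _ h => hcell (h.2.mono (subset_insert _ _))
  obtain ⟨a, ha⟩ := hR
  obtain ⟨b, hb⟩ := hD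
  omega

end IsRankCell

/-- **Scarf's lemma** without boundary conditions: for every colouring of a finite set with
injective rankings indexed by the colours there is a finset `σ` such that every point is ranked
below all of `σ` in a ranking whose colour occurs in `σ`. -/
theorem exists_finset_forall_exists_rank_le {I T : Type*} [Finite I] [Finite T] [Nonempty T]
    [DecidableEq I] {r : I → T → ℕ} (hr : ∀ i, Function.Injective (r i)) (c : T → I) :
    ∃ σ : Finset T, ∀ x, ∃ i ∈ σ.image c, ∀ y ∈ σ, r i x ≤ r i y := by
  classical
  cases nonempty_fintype I
  cases nonempty_fintype T
  obtain ⟨t₀⟩ := ‹Nonempty T›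
  have : Nonempty I := ⟨c t₀⟩
  obtain ⟨M, hM⟩ : ∃ M, ∀ i t, r i t < M :=
    ⟨(univ.sup fun p : I × T => r p.1 p.2) + 1, fun i t =>
      Nat.lt_succ_of_le (le_sup (f := fun p : I × T => r p.1 p.2) (mem_univ (i, t)))⟩
  let e := Fintype.equivFin I
  let r' : I → T ⊕ I → ℕ := fun i =>
    Sum.elim (fun t => r i t + 1) fun j => if j = i then 0 else M + 1 + e j
  have hr' : ∀ i, Function.Injective (r' i) := by
    rintro i (t | j) (t' | j') h
    · simp only [r', Sum.elim_inl, add_left_inj] at h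
      rw [hr i h]
    · simp only [r', Sum.elim_inl, Sum.elim_inr] at h
      have := hM i t
      split_ifs at h
      omega
    · simp only [r', Sum.elim_inl, Sum.elim_inr] at h
      have := hM i t'
      split_ifs at h
      omega
    · simp only [r', Sum.elim_inr] at h
      split_ifs at h with h1 h2 h2
      · rw [h1, h2]
      · omega
      · omega
      · rw [e.injective (Fin.ext (by omega : (e j : ℕ) = e j'))]
  obtain ⟨S, hS, himg⟩ := IsRankCell.exists_image_eq_univ (r := r') (s := Sum.inr)
    (c := Sum.elim c id) (x₀ := Sum.inl t₀) hr'
    (by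
      rintro i (t | j) h
      · simp [r']
      · have : j ≠ i := fun h' => h (by rw [h'])
        simp [r', this])
    (by
      rintro i j (t | l) hj h
      · have := hM i t
        simp only [r', Sum.elim_inl, Sum.elim_inr, if_neg hj]
        omega
      · exact absurd ⟨l, rfl⟩ h)
    (by simp) (fun _ => rfl)
  refine ⟨S.preimage Sum.inl Sum.inl_injective.injOn, fun x => ?_⟩
  obtain ⟨i, hi⟩ := hS (Sum.inl x)
  refine ⟨i, ?_, fun y hy => by simpa [r'] using hi _ (mem_preimage.1 hy)⟩
  obtain ⟨y | j, hy, hyi⟩ := mem_image.1 (himg ▸ mem_univ i)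
  · exact mem_image.2 ⟨y, mem_preimage.2 hy, hyi⟩
  · obtain rfl : j = i := hyi
    simpa [r'] using hi _ hy

/-- The grid form of Scarf's lemma: for every colouring of the lattice points of the simplex of
size `N` there are a point `y` and, for every colour `i`, a point `z` near `y` that has colour `i`
or nearly vanishing `i`-th coordinate. -/
theorem exists_piAntidiag_near {ι : Type*} [Fintype ι] [DecidableEq ι] [Nonempty ι] (N : ℕ)
    (c : (ι → ℕ) → ι) :
    ∃ y ∈ piAntidiag univ N, ∀ i, ∃ z ∈ piAntidiag univ N,
      (∀ j, y j ≤ z j + Fintype.card ι ∧ z j ≤ y j + Fintype.card ι) ∧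
      (c z = i ∨ z i ≤ Fintype.card ι) := by
  have hmem : ∀ a : ι → ℕ, a ∈ piAntidiag univ N ↔ ∑ i, a i = N := fun a => by
    simp [mem_piAntidiag]
  obtain ⟨i₁⟩ := ‹Nonempty ι›
  let T : Finset (ι → ℕ) := piAntidiag univ N
  have : Nonempty T := ⟨⟨Pi.single i₁ N, by rw [hmem]; simp⟩⟩
  let e := Fintype.equivFin T
  let r : ι → T → ℕ := fun i a => e a + Fintype.card T * a.1 i
  have hrle : ∀ i a b, r i a ≤ r i b → a.1 i ≤ b.1 i := by
    intro i a b h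
    by_contra! hlt
    have h1 := Nat.mul_le_mul_left (Fintype.card T) (Nat.succ_le_of_lt hlt)
    have h2 := (e b).isLt
    rw [Nat.mul_succ] at h1
    simp only [r] at h
    omega
  have hr : ∀ i, Function.Injective (r i) := by
    intro i a b h
    have h1 := le_antisymm (hrle i a b h.le) (hrle i b a h.ge)
    simp only [r, h1] at h
    exact e.injective (Fin.ext (by omega))
  obtain ⟨σ, hσ⟩ := exists_finset_forall_exists_rank_le hr fun a => c a.1
  set C := σ.image fun a => c a.1 with hC
  obtain ⟨a₀⟩ := ‹Nonempty T›
  obtain ⟨i₀, hi₀, -⟩ := hσ a₀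
  obtain ⟨y, hy, -⟩ := mem_image.1 hi₀
  have hmin : ∀ i, ∃ k, (∀ a ∈ σ, k ≤ a.1 i) ∧ ∃ a ∈ σ, k = a.1 i := fun i => by
    obtain ⟨a, ha, hm⟩ := exists_min_image σ (fun a => a.1 i) ⟨y, hy⟩
    exact ⟨a.1 i, hm, a, ha, rfl⟩
  choose k hk hkm using hmin
  let m : ι → ℕ := fun i => if i ∈ C then k i else 0
  have hm : ∀ a ∈ σ, ∀ i, m i ≤ a.1 i := by
    intro a ha i
    simp only [m]
    split_ifs
    · exact hk i a ha
    · exact Nat.zero_le _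
  have hsum : N < ∑ i, m i + Fintype.card ι := by
    by_contra! hN
    obtain ⟨d, hd⟩ := Nat.exists_eq_add_of_le hN
    let x : ι → ℕ := fun i => m i + 1 + (Pi.single i₀ d : ι → ℕ) i
    have hx : x ∈ piAntidiag univ N := by
      rw [hmem, hd]
      simp [x, sum_add_distrib]
    obtain ⟨i, hi, hi'⟩ := hσ ⟨x, hx⟩
    obtain ⟨a, ha, hka⟩ := hkm i
    have := hrle i _ _ (hi' a ha)
    simp only [x, m, if_pos hi, hka] at this
    omega
  have hle : ∀ a ∈ σ, ∀ i, a.1 i ≤ m i + Fintype.card ι := by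
    intro a ha i
    have h1 : ∑ j, a.1 j = N := (hmem _).1 a.2
    have h2 : a.1 i + ∑ j ∈ univ.erase i, a.1 j = N := by rw [add_sum_erase _ _ (mem_univ i), h1]
    have h3 := add_sum_erase univ m (mem_univ i)
    have h4 := sum_le_sum fun j (_ : j ∈ univ.erase i) => hm a ha j
    omega
  refine ⟨y.1, y.2, fun i => ?_⟩
  have hnear : ∀ z ∈ σ, ∀ j, y.1 j ≤ z.1 j + Fintype.card ι ∧ z.1 j ≤ y.1 j + Fintype.card ι :=
    fun z hz j => ⟨(hle y hy j).trans (Nat.add_le_add_right (hm z hz j) _),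
      (hle z hz j).trans (Nat.add_le_add_right (hm y hy j) _)⟩
  by_cases hi : i ∈ C
  · obtain ⟨z, hz, hzi⟩ := mem_image.1 hi
    exact ⟨z.1, z.2, hnear z hz, Or.inl hzi⟩
  · refine ⟨y.1, y.2, hnear y hy, Or.inr ?_⟩
    simpa [m, hi] using hle y hy i

/-- A complementarity theorem equivalent to Brouwer's: if continuous functions `g i` on a simplex
are such that at every point one of them is nonpositive, then there is a point `t` at which `g i`
is nonpositive for all `i` with `t i ≠ 0`. -/
theorem exists_mem_stdSimplex_complementarity {ι : Type*} [Fintype ι] [Nonempty ι]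
    {g : (ι → ℝ) → ι → ℝ} (hg : ∀ i, Continuous fun t => g t i)
    (h : ∀ t ∈ stdSimplex ℝ ι, ∃ i, g t i ≤ 0) :
    ∃ t ∈ stdSimplex ℝ ι, ∀ i, t i = 0 ∨ g t i ≤ 0 := by
  classical
  set K : ℝ := (Fintype.card ι : ℝ) with hK
  have hstep : ∀ n : ℕ, ∃ y ∈ stdSimplex ℝ ι, ∀ i, ∃ z ∈ stdSimplex ℝ ι,
      dist z y ≤ K / (n + 1) ∧ min (z i) (g z i) ≤ K / (n + 1) := by
    intro n
    have hn : (0 : ℝ) < n + 1 := by positivity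
    let p : (ι → ℕ) → ι → ℝ := fun a i => a i / (n + 1)
    have hp : ∀ a ∈ piAntidiag univ (n + 1), p a ∈ stdSimplex ℝ ι := by
      intro a ha
      refine ⟨fun i => by positivity, ?_⟩
      have : ∑ i, (a i : ℝ) = n + 1 := by exact_mod_cast (mem_piAntidiag.1 ha).1
      simp only [p]
      rw [← sum_div, this, div_self hn.ne']
    choose! c hc using h
    obtain ⟨y, hy, hyz⟩ := exists_piAntidiag_near (n + 1) fun a => c (p a)
    refine ⟨p y, hp y hy, fun i => ?_⟩
    obtain ⟨z, hz, hd, hz'⟩ := hyz i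
    refine ⟨p z, hp z hz, (dist_pi_le_iff (by positivity)).2 fun j => ?_, ?_⟩
    · have h1 : (y j : ℝ) ≤ z j + K := by rw [hK]; exact_mod_cast (hd j).1
      have h2 : (z j : ℝ) ≤ y j + K := by rw [hK]; exact_mod_cast (hd j).2
      simp only [p]
      rw [Real.dist_eq, ← sub_div, abs_div, abs_of_pos hn]
      gcongr
      exact abs_le.2 ⟨by linarith, by linarith⟩
    · rcases hz' with hzi | hzi
      · exact (min_le_right _ _).trans ((hzi ▸ hc _ (hp z hz)).trans (by positivity))
      · refine (min_le_left _ _).trans ?_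
        have : (z i : ℝ) ≤ K := by rw [hK]; exact_mod_cast hzi
        simp only [p]
        gcongr
  choose y hy z hz hd hmin using hstep
  obtain ⟨t, ht, φ, hφ, hlim⟩ := (isCompact_stdSimplex ℝ ι).tendsto_subseq hy
  refine ⟨t, ht, fun i => ?_⟩
  have h0 : Tendsto (fun n : ℕ => K / ((φ n : ℝ) + 1)) atTop (𝓝 0) := by
    have : Tendsto (fun n : ℕ => K / ((n : ℝ) + 1)) atTop (𝓝 0) := by
      simpa [div_eq_mul_inv] using tendsto_one_div_add_atTop_nhds_zero_nat.const_mul K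
    exact this.comp hφ.tendsto_atTop
  have hzlim : Tendsto (fun n => z (φ n) i) atTop (𝓝 t) :=
    hlim.congr_dist (squeeze_zero (fun _ => dist_nonneg)
      (fun n => by rw [dist_comm]; exact hd (φ n) i) h0)
  have hcont : Continuous fun t : ι → ℝ => min (t i) (g t i) := (continuous_apply i).min (hg i)
  have hle := le_of_tendsto_of_tendsto' ((hcont.tendsto t).comp hzlim) h0 fun n => hmin (φ n) i
  exact (min_le_iff.1 hle).imp_left fun h => le_antisymm h (ht.1 i)

/-- The **Hartman–Stampacchia** theorem for polytopes: a continuous vector field `h` has a point `x`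
maximising `h x` over the polytope. -/
theorem exists_mem_convexHull_forall_dotProduct_le {κ : Type*} [Fintype κ] {V : Finset (κ → ℝ)}
    (hV : V.Nonempty) {h : (κ → ℝ) → κ → ℝ} (hh : Continuous h) :
    ∃ x ∈ convexHull ℝ (V : Set (κ → ℝ)),
      ∀ z ∈ convexHull ℝ (V : Set (κ → ℝ)), h x ⬝ᵥ z ≤ h x ⬝ᵥ x := by
  have : Nonempty V := hV.to_subtype
  let x : (V → ℝ) → κ → ℝ := fun t => ∑ v, t v • (v : κ → ℝ)
  have hx : Continuous x := by fun_prop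
  have hxV : ∀ t ∈ stdSimplex ℝ V, x t ∈ convexHull ℝ (V : Set (κ → ℝ)) := fun t ht =>
    mem_convexHull_of_exists_fintype t _ ht.1 ht.2 (fun v => v.2) rfl
  let g : (V → ℝ) → V → ℝ := fun t v =>
    ∑ w : V, max 0 (h (x t) ⬝ᵥ (w : κ → ℝ) - h (x t) ⬝ᵥ (v : κ → ℝ))
  have hg0 : ∀ t v, g t v ≤ 0 ↔ ∀ w : V, h (x t) ⬝ᵥ (w : κ → ℝ) ≤ h (x t) ⬝ᵥ (v : κ → ℝ) := by
    intro t v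
    have hnn : ∀ w ∈ (univ : Finset V),
        0 ≤ max 0 (h (x t) ⬝ᵥ (w : κ → ℝ) - h (x t) ⬝ᵥ (v : κ → ℝ)) := fun w _ => le_max_left _ _
    change ∑ w : V, max 0 _ ≤ 0 ↔ _
    rw [(sum_nonneg hnn).ge_iff_eq', sum_eq_zero_iff_of_nonneg hnn]
    simp
  obtain ⟨t, ht, htg⟩ := exists_mem_stdSimplex_complementarity (g := g)
    (fun v => by simp only [g, dotProduct]; fun_prop) fun t _ => by
      obtain ⟨v, -, hv⟩ := exists_max_image univ (fun w : V => h (x t) ⬝ᵥ (w : κ → ℝ)) univ_nonempty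
      exact ⟨v, (hg0 t v).2 fun w => hv w (mem_univ w)⟩
  refine ⟨x t, hxV t ht, ?_⟩
  have hmain : ∀ w : V, h (x t) ⬝ᵥ (w : κ → ℝ) ≤ h (x t) ⬝ᵥ x t := by
    intro w
    calc h (x t) ⬝ᵥ (w : κ → ℝ) = ∑ v, t v * (h (x t) ⬝ᵥ (w : κ → ℝ)) := by
          rw [← sum_mul, ht.2, one_mul]
      _ ≤ ∑ v, t v * (h (x t) ⬝ᵥ (v : κ → ℝ)) := by
          refine sum_le_sum fun v _ => ?_
          rcases htg v with hv | hv
          · simp [hv]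
          · exact mul_le_mul_of_nonneg_left ((hg0 t v).1 hv w) (ht.1 v)
      _ = h (x t) ⬝ᵥ x t := by
          rw [show x t = ∑ v, t v • (v : κ → ℝ) from rfl, dotProduct_sum]
          simp [dotProduct_smul]
  have hconv : Convex ℝ {z | h (x t) ⬝ᵥ z ≤ h (x t) ⬝ᵥ x t} :=
    convex_halfSpace_le ⟨fun a b => dotProduct_add _ a b, fun c a => dotProduct_smul c _ a⟩ _
  exact fun z hz => convexHull_min (fun w hw => hmain ⟨w, hw⟩) hconv hz

/-- A polytope has finitely many exposed faces. -/
theorem finite_setOf_isExposed_convexHull {E : Type*} [AddCommGroup E] [Module ℝ E]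
    [TopologicalSpace E] [T2Space E] [IsTopologicalAddGroup E] [ContinuousSMul ℝ E]
    [LocallyConvexSpace ℝ E] {V : Set E} (hV : V.Finite) :
    {σ | IsExposed ℝ (convexHull ℝ V) σ}.Finite := by
  have hc := hV.isCompact_convexHull ℝ
  refine Set.Finite.of_finite_image (f := fun σ => σ ∩ (convexHull ℝ V).extremePoints ℝ)
    (hV.finite_subsets.subset ?_) ?_
  · rintro _ ⟨σ, -, rfl⟩
    exact Set.inter_subset_right.trans extremePoints_convexHull_subset
  · intro σ hσ τ hτ (h : σ ∩ _ = τ ∩ _)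
    have key : ∀ {σ}, IsExposed ℝ (convexHull ℝ V) σ →
        closure (convexHull ℝ (σ ∩ (convexHull ℝ V).extremePoints ℝ)) = σ := fun {σ} hσ => by
      rw [← hσ.isExtreme.extremePoints_eq]
      exact closure_convexHull_extremePoints (hσ.isCompact hc) (hσ.convex (convex_convexHull ℝ V))
    rw [← key hσ, h, key hτ]

/-- Given finitely many closed sets, every point has a ball meeting only those that contain it. -/
theorem exists_ball_subset_compl_of_finite {X : Type*} [PseudoMetricSpace X] {S : Set (Set X)}
    (hS : S.Finite) (hcl : ∀ s ∈ S, IsClosed s) (x : X) :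
    ∃ ε > 0, ∀ s ∈ S, ∀ z ∈ s, dist z x < ε → x ∈ s := by
  have hclosed : IsClosed (⋃ s ∈ {s ∈ S | x ∉ s}, s) :=
    (hS.subset (Set.sep_subset _ _)).isClosed_biUnion fun s hs => hcl s hs.1
  obtain ⟨ε, hε, hball⟩ := Metric.isOpen_iff.1 hclosed.isOpen_compl x (by simp)
  refine ⟨ε, hε, fun s hs z hz hd => ?_⟩
  by_contra hx
  exact hball hd (Set.mem_biUnion (show s ∈ {s ∈ S | x ∉ s} from ⟨hs, hx⟩) hz)

/-- **Komiya's theorem.** Let `P ⊆ ℝ^k` be a polytope, and for every nonempty (exposed)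
face `σ` of `P` (including `P` itself) choose a point `y σ ∈ σ` and a closed set `A σ ⊆ P`.
If `σ ⊆ ⋃ {A τ : τ ⊆ σ a nonempty face}` for every nonempty face `σ`, then there are
nonempty faces `σ₁, …, σ_m` with `y P ∈ conv{y σ₁, …, y σ_m}` and `⋂ i, A (σ i) ≠ ∅`. -/
theorem komiya (k : ℕ) (V : Finset (Fin k → ℝ)) (P : Set (Fin k → ℝ))
    (hP : P = convexHull ℝ (V : Set (Fin k → ℝ)))
    (hPne : P.Nonempty)
    (y : Set (Fin k → ℝ) → Fin k → ℝ)
    (A : Set (Fin k → ℝ) → Set (Fin k → ℝ))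
    (hy : ∀ σ, IsExposed ℝ P σ → σ.Nonempty → y σ ∈ σ)
    (hAclosed : ∀ σ, IsExposed ℝ P σ → σ.Nonempty → IsClosed (A σ))
    (hAsub : ∀ σ, IsExposed ℝ P σ → σ.Nonempty → A σ ⊆ P)
    (hcover : ∀ σ, IsExposed ℝ P σ → σ.Nonempty →
      σ ⊆ ⋃ τ ∈ {τ | IsExposed ℝ P τ ∧ τ.Nonempty ∧ τ ⊆ σ}, A τ) :
    ∃ (m : ℕ) (σs : Fin m → Set (Fin k → ℝ)),
      (∀ i, IsExposed ℝ P (σs i) ∧ (σs i).Nonempty) ∧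
      y P ∈ convexHull ℝ (Set.range fun i => y (σs i)) ∧
      (⋂ i, A (σs i)).Nonempty := by
  classical
  have hPc : IsCompact P := hP ▸ V.finite_toSet.isCompact_convexHull ℝ
  have hVne : V.Nonempty := by
    rw [hP, convexHull_nonempty_iff] at hPne
    exact hPne
  have hPP : IsExposed ℝ P P := IsExposed.refl P
  have hfin : {σ | IsExposed ℝ P σ}.Finite := hP ▸ finite_setOf_isExposed_convexHull V.finite_toSet
  -- every point lies in a set `A τ` with `τ` contained in every face through the point
  have hlabel : ∀ x ∈ P, ∃ τ, IsExposed ℝ P τ ∧ τ.Nonempty ∧ x ∈ A τ ∧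
      ∀ σ, IsExposed ℝ P σ → x ∈ σ → τ ⊆ σ := by
    intro x hx
    have hf : {σ | IsExposed ℝ P σ ∧ x ∈ σ}.Finite := hfin.subset fun _ h => h.1
    have hexp : IsExposed ℝ P (⋂₀ {σ | IsExposed ℝ P σ ∧ x ∈ σ}) := by
      have := IsExposed.sInter (F := hf.toFinset) ⟨P, by simpa using ⟨hPP, hx⟩⟩
        fun B hB => (hf.mem_toFinset.1 hB).1
      rwa [hf.coe_toFinset] at this
    have hxI : x ∈ ⋂₀ {σ | IsExposed ℝ P σ ∧ x ∈ σ} := fun σ hσ => hσ.2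
    obtain ⟨τ, ⟨hτ, hτne, hτs⟩, hxτ⟩ := Set.mem_iUnion₂.1 (hcover _ hexp ⟨x, hxI⟩ hxI)
    exact ⟨τ, hτ, hτne, hxτ, fun σ hσ hxσ => hτs.trans (Set.sInter_subset_of_mem ⟨hσ, hxσ⟩)⟩
  choose! τ hτ hτne hxτ hτmin using hlabel
  have hrad : ∀ x, ∃ ε > 0, ∀ s ∈ {σ | IsExposed ℝ P σ} ∪ A '' {σ | IsExposed ℝ P σ ∧ σ.Nonempty},
      ∀ z ∈ s, dist z x < ε → x ∈ s := by
    refine exists_ball_subset_compl_of_finite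
      (hfin.union ((hfin.subset fun _ h => h.1).image A)) ?_
    rintro s (hs | ⟨σ, hσ, rfl⟩)
    · exact hs.isClosed hPc.isClosed
    · exact hAclosed σ hσ.1 hσ.2
  choose ε hε hball using hrad
  obtain ⟨J, hJP, hJ⟩ := hPc.elim_nhds_subcover (fun x => Metric.ball x (ε x / 2))
    fun x _ => Metric.ball_mem_nhds x (half_pos (hε x))
  let ψ : (Fin k → ℝ) → (Fin k → ℝ) → ℝ := fun j x => max 0 (ε j / 2 - dist x j)
  have hψ0 : ∀ j x, 0 ≤ ψ j x := fun j x => le_max_left _ _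
  have hψ : ∀ {j x}, 0 < ψ j x ↔ dist x j < ε j / 2 := fun {j x} => by simp [ψ]
  let h : (Fin k → ℝ) → Fin k → ℝ := fun x => ∑ j ∈ J, ψ j x • (y P - y (τ j))
  have hh : Continuous h := by simp only [h, ψ]; fun_prop
  obtain ⟨x, hxP, hx⟩ := exists_mem_convexHull_forall_dotProduct_le hVne hh
  rw [← hP] at hxP hx
  have hface : IsExposed ℝ P {z ∈ P | ∀ w ∈ P, h x ⬝ᵥ w ≤ h x ⬝ᵥ z} := fun _ =>
    ⟨LinearMap.toContinuousLinearMap (dotProductBilin ℝ ℝ (h x)), rfl⟩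
  have hyP : y P ∈ P := hy P hPP hPne
  have hle : h x ⬝ᵥ h x ≤ 0 := by
    have hexpand : h x ⬝ᵥ h x = ∑ j ∈ J, ψ j x * (h x ⬝ᵥ y P - h x ⬝ᵥ y (τ j)) := by
      change h x ⬝ᵥ (∑ j ∈ J, ψ j x • (y P - y (τ j))) = _
      simp [dotProduct_sum, dotProduct_smul, dotProduct_sub]
    rw [hexpand]
    refine sum_nonpos fun j hj => ?_
    rcases (hψ0 j x).eq_or_lt with h0 | hpos
    · rw [← h0, zero_mul]
    · have hjF := hball j _ (Or.inl hface) x ⟨hxP, hx⟩ ((hψ.1 hpos).trans (half_lt_self (hε j)))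
      have hyF := hτmin j (hJP j hj) _ hface hjF
        (hy _ (hτ j (hJP j hj)) (hτne j (hJP j hj)))
      exact mul_nonpos_of_nonneg_of_nonpos hpos.le (sub_nonpos.2 (hyF.2 _ hyP))
  have hzero : h x = 0 := dotProduct_self_eq_zero.1 (le_antisymm hle (by
    simpa using dotProduct_star_self_nonneg (h x)))
  obtain ⟨j₀, hj₀, hj₀x⟩ : ∃ j ∈ J, 0 < ψ j x := by
    obtain ⟨j, hj, hjx⟩ := Set.mem_iUnion₂.1 (hJ hxP)
    exact ⟨j, hj, hψ.2 hjx⟩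
  set J' := J.filter fun j => 0 < ψ j x with hJ'
  obtain ⟨a, ha, hamax⟩ := exists_max_image J' ε ⟨j₀, mem_filter.2 ⟨hj₀, hj₀x⟩⟩
  have hmem : ∀ j ∈ J', IsExposed ℝ P (τ j) ∧ (τ j).Nonempty := fun j hj =>
    have hjP := hJP j (mem_filter.1 hj).1
    ⟨hτ j hjP, hτne j hjP⟩
  refine ⟨#J', fun i => τ (J'.equivFin.symm i), fun i => hmem _ (J'.equivFin.symm i).2, ?_, a,
    Set.mem_iInter.2 fun i => ?_⟩
  · have hsum : 0 < ∑ j ∈ J', ψ j x :=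
      sum_pos (fun j hj => (mem_filter.1 hj).2) ⟨a, ha⟩
    have hcm : J'.centerMass (fun j => ψ j x) (fun j => y (τ j)) = y P := by
      have h1 : ∑ j ∈ J', ψ j x • (y P - y (τ j)) = 0 := by
        rw [← hzero, hJ', sum_filter_of_ne]
        exact fun j _ hj => (hψ0 j x).lt_of_ne fun h0 => hj (by rw [← h0, zero_smul])
      simp only [smul_sub, sum_sub_distrib, ← sum_smul, sub_eq_zero] at h1
      rw [centerMass, ← h1, inv_smul_smul₀ hsum.ne']
    rw [← hcm]
    exact centerMass_mem_convexHull _ (fun j _ => hψ0 j x) hsum fun j hj =>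
      ⟨J'.equivFin ⟨j, hj⟩, by simp⟩
  · change a ∈ A (τ (J'.equivFin.symm i))
    obtain ⟨j, hj⟩ := J'.equivFin.symm i
    have hjP := hJP j (mem_filter.1 hj).1
    refine hball a (A (τ j)) (Or.inr ⟨τ j, hmem j hj, rfl⟩) j (hxτ j hjP) ?_
    have h1 := hψ.1 (mem_filter.1 hj).2
    have h2 := hψ.1 (mem_filter.1 ha).2
    have h3 := dist_triangle_left j a x
    have h4 := hamax j hj
    linarith
end

section
/- Let T be a triangulation of a polytope P ⊆ ℝ^k, and let f : V(T) → {nonempty faces of P} be a Sperner–Shapley labeling of T, i.e., f(v) ⊆ supp(v) for every vertex v of T, where supp(v) is the minimal face of P containing v. For every nonempty face σ of P choose a point y_σ ∈ σ. Then there is a face τ of T such that y_P ∈ conv{y_{f(v)} : v a vertex of τ}. -/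
/-- In a set `U` with as many elements as there are colours, not all of which occur, the number of
elements whose removal leaves exactly the colours different from `i₀` is even. -/
lemma even_card_filter_image_erase {X I : Type*} [DecidableEq X] [DecidableEq I] [Fintype I]
    (c : X → I) (i₀ : I) (U : Finset X) (hU : U.card = Fintype.card I)
    (h : U.image c ≠ Finset.univ) :
    Even (U.filter fun u => (U.erase u).image c = Finset.univ.erase i₀).card := by
  rcases (U.filter fun u => (U.erase u).image c = Finset.univ.erase i₀).eq_empty_or_nonempty
    with h₀ | ⟨u, hu⟩
  · simp [h₀]
  obtain ⟨huU, hu⟩ := Finset.mem_filter.1 hu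
  have hinj : Set.InjOn c (U.erase u : Finset X) := by
    rw [← Finset.card_image_iff, hu, Finset.card_erase_of_mem huU, hU,
      Finset.card_erase_of_mem (Finset.mem_univ _), Finset.card_univ]
  have hmem : ∀ j, j ≠ i₀ ↔ ∃ v, (v ≠ u ∧ v ∈ U) ∧ c v = j := fun j => by
    have := congrArg (j ∈ ·) hu
    simpa using this.symm
  have hne : c u ≠ i₀ := by
    intro hc
    refine h (Finset.eq_univ_of_forall fun j => Finset.mem_image.2 ?_)
    by_cases hj : j = i₀
    · exact ⟨u, huU, hc.trans hj.symm⟩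
    · obtain ⟨v, hv, rfl⟩ := (hmem j).1 hj
      exact ⟨v, hv.2, rfl⟩
  obtain ⟨v, ⟨hvu, hvU⟩, hv⟩ := (hmem _).1 hne
  have hinj' : ∀ x ∈ U, ∀ y ∈ U, x ≠ u → y ≠ u → c x = c y → x = y := fun x hx y hy hxu hyu hxy =>
    hinj (by simp [hxu, hx]) (by simp [hyu, hy]) hxy
  have hpair : (U.filter fun u => (U.erase u).image c = Finset.univ.erase i₀) = {u, v} := by
    ext x
    simp only [Finset.mem_filter, Finset.mem_insert, Finset.mem_singleton]
    constructor
    · rintro ⟨hxU, hx⟩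
      by_contra! hxne
      have hcx : c x ≠ i₀ := (hmem _).2 ⟨x, ⟨hxne.1, hxU⟩, rfl⟩
      have : c x ∈ (U.erase x).image c := by rw [hx]; simp [hcx]
      obtain ⟨y, hy, hyx⟩ := Finset.mem_image.1 this
      obtain ⟨hyx', hyU⟩ := Finset.mem_erase.1 hy
      by_cases hyu : y = u
      · subst hyu
        exact hxne.2 (hinj' _ hxU _ hvU hxne.1 hvu (hyx.symm.trans hv.symm))
      · exact hyx' (hinj' _ hyU _ hxU hyu hxne.1 hyx)
    · rintro (rfl | rfl)
      · exact ⟨huU, hu⟩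
      · refine ⟨hvU, ?_⟩
        ext j
        simp only [Finset.mem_image, Finset.mem_erase, Finset.mem_univ, and_true, hmem]
        constructor
        · rintro ⟨z, ⟨hzx, hzU⟩, rfl⟩
          by_cases hzu : z = u
          · subst hzu
            exact ⟨x, ⟨hvu, hvU⟩, hv⟩
          · exact ⟨z, ⟨hzu, hzU⟩, rfl⟩
        · rintro ⟨z, ⟨hzu, hzU⟩, rfl⟩
          by_cases hzx : z = x
          · subst hzx
            exact ⟨u, ⟨hvu.symm, huU⟩, hv.symm⟩
          · exact ⟨z, ⟨hzx, hzU⟩, rfl⟩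
  rw [hpair, Finset.card_pair hvu.symm]
  exact even_two

/-- A finite set `U` is dominant for a family of weights `w` if every point lies weakly below all
of `U` with respect to some weight. -/
def IsDominant {X I : Type*} (w : I → X → ℤ) (U : Finset X) : Prop :=
  ∀ y, ∃ i, ∀ u ∈ U, w i y ≤ w i u

section Scarf

variable {X I : Type*} [Fintype X] [DecidableEq X] [Fintype I] [DecidableEq I]
  {w : I → X → ℤ} {s : I → X}

open Classical in
/-- A set of one element less than there are weights, containing a non-slack point, extends to an
even number of dominant sets by adding one element. -/
lemma even_card_dominant_insert (hw : ∀ i, Function.Injective (w i)) (hs : Function.Injective s)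
    (hmin : ∀ i x, w i (s i) ≤ w i x)
    (hbig : ∀ i j, j ≠ i → ∀ t, t ∉ Set.range s → w i t < w i (s j))
    (W : Finset X) (hW : W.card + 1 = Fintype.card I) (t₀ : X) (ht₀ : t₀ ∈ W)
    (ht₀s : t₀ ∉ Set.range s) :
    Even (Finset.univ.filter fun x => x ∉ W ∧ IsDominant w (insert x W)).card := by
  by_cases hdom : IsDominant w W
  swap
  · rw [Finset.filter_false_of_mem]
    · simp
    · rintro x - ⟨-, hx⟩
      exact hdom fun y => (hx y).imp fun i hi u hu => hi u (Finset.mem_insert_of_mem hu)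
  have hm : ∀ i, ∃ m ∈ W, ∀ u ∈ W, w i m ≤ w i u := fun i =>
    W.exists_min_image (w i) ⟨t₀, ht₀⟩
  choose m hmW hm using hm
  have hmeq : ∀ i, ∀ x ∈ W, w i x ≤ w i (m i) → x = m i := fun i x hx h =>
    hw i (le_antisymm h (hm i x hx))
  have hsurj : ∀ x ∈ W, ∃ i, m i = x := fun x hx => by
    obtain ⟨i, hi⟩ := hdom x
    exact ⟨i, (hmeq i x hx (hi _ (hmW i))).symm⟩
  obtain ⟨a, -, b, -, hab, hmab⟩ := Finset.exists_ne_map_eq_of_card_lt_of_maps_to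
    (s := Finset.univ) (t := W) (f := m) (by rw [Finset.card_univ]; omega) (fun i _ => hmW i)
  have huniq : ∀ i j, i ≠ a → i ≠ b → m j = m i → j = i := by
    intro i j hia hib hji
    by_contra hne
    have hsub : W ⊆ ((Finset.univ.erase i).erase a).image m := by
      intro x hx
      obtain ⟨k, rfl⟩ := hsurj x hx
      rw [Finset.mem_image]
      by_cases hka : k = a
      · exact ⟨b, by simp [hab.symm, hib.symm], by rw [hka, hmab]⟩
      by_cases hki : k = i
      · by_cases hja : j = a
        · exact ⟨b, by simp [hab.symm, hib.symm], by rw [hki, ← hji, hja, hmab]⟩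
        · exact ⟨j, by simp [hne, hja], by rw [hki, hji]⟩
      · exact ⟨k, by simp [hka, hki], rfl⟩
    have h₁ := (Finset.card_le_card hsub).trans Finset.card_image_le
    rw [Finset.card_erase_of_mem (by simp [hia.symm]), Finset.card_erase_of_mem (by simp),
      Finset.card_univ] at h₁
    have : 0 < W.card := Finset.card_pos.2 ⟨t₀, ht₀⟩
    omega
  let S : I → Finset X := fun a => Finset.univ.filter fun y => ∀ i, i ≠ a → w i (m i) < w i y
  have memS : ∀ a y, y ∈ S a ↔ ∀ i, i ≠ a → w i (m i) < w i y := by simp [S]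
  have hsS : ∀ a, s a ∈ S a := by
    intro a
    rw [memS]
    intro i hia
    by_cases hmi : m i ∈ Set.range s
    · obtain ⟨k, hk⟩ := hmi
      have hki : k = i := by
        by_contra hki
        have := hbig i k hki t₀ ht₀s
        have := hm i t₀ ht₀
        rw [← hk] at this
        omega
      rw [← hk, hki]
      exact lt_of_le_of_ne (hmin i _) fun h => hia (hs (hw i h))
    · exact hbig i a hia.symm _ hmi
  have hx : ∀ a, ∃ x ∈ S a, ∀ y ∈ S a, w a y ≤ w a x := fun a =>
    (S a).exists_max_image (w a) ⟨_, hsS a⟩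
  choose x hxS hxmax using hx
  have hdomS : ∀ a, ∀ y ∈ S a, ∀ u ∈ W, w a y ≤ w a u := by
    intro a y hy u hu
    obtain ⟨i, hi⟩ := hdom y
    by_cases hia : i = a
    · exact hia ▸ hi u hu
    · exact absurd (hi _ (hmW i)) (not_le.2 ((memS a y).1 hy i hia))
  have hxdom : ∀ a, IsDominant w (insert (x a) W) := by
    intro a y
    by_cases hy : y ∈ S a
    · refine ⟨a, fun u hu => ?_⟩
      rcases Finset.mem_insert.1 hu with rfl | hu
      · exact hxmax a y hy
      · exact hdomS a y hy u hu
    · rw [memS] at hy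
      push Not at hy
      obtain ⟨i, hia, hi⟩ := hy
      refine ⟨i, fun u hu => ?_⟩
      rcases Finset.mem_insert.1 hu with rfl | hu
      · exact hi.trans ((memS a _).1 (hxS a) i hia).le
      · exact hi.trans (hm i u hu)
  have hxW : ∀ a b, a ≠ b → m a = m b → x a ∉ W := by
    intro a b hab hmab hxW
    obtain ⟨i, hi⟩ := hsurj _ hxW
    have hxa := (memS a _).1 (hxS a)
    by_cases hia : i = a
    · have := hxa b hab.symm
      rw [← hmab, ← hia, hi, hia] at this
      exact lt_irrefl _ this
    · have := hxa i hia
      rw [hi] at this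
      exact lt_irrefl _ this
  have hpair : (Finset.univ.filter fun x => x ∉ W ∧ IsDominant w (insert x W)) = {x a, x b} := by
    ext z
    simp only [Finset.mem_filter, Finset.mem_univ, true_and, Finset.mem_insert,
      Finset.mem_singleton]
    constructor
    · rintro ⟨hzW, hz⟩
      have key : ∀ j, ∃ i, m i = m j ∧ w i (m i) < w i z := by
        intro j
        obtain ⟨i, hi⟩ := hz (m j)
        have hij := hmeq i _ (hmW j) (hi _ (Finset.mem_insert_of_mem (hmW i)))
        refine ⟨i, hij.symm, lt_of_le_of_ne (hij ▸ hi z (Finset.mem_insert_self _ _)) fun h => ?_⟩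
        exact hzW (hw i h ▸ hmW i)
      have hother : ∀ i, i ≠ a → i ≠ b → w i (m i) < w i z := by
        intro i hia hib
        obtain ⟨j, hj, hlt⟩ := key i
        rwa [huniq i j hia hib hj] at hlt
      have hmax : ∀ a, z ∈ S a → z = x a := by
        intro a hza
        refine hw a (le_antisymm (hxmax a z hza) ?_)
        obtain ⟨i, hi⟩ := hz (x a)
        by_cases hia : i = a
        · exact hia ▸ hi z (Finset.mem_insert_self _ _)
        · exact absurd (hi _ (Finset.mem_insert_of_mem (hmW i)))
            (not_le.2 ((memS a _).1 (hxS a) i hia))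
      obtain ⟨i, hi, hlt⟩ := key a
      by_cases hia : i = a
      · right
        apply hmax
        rw [memS]
        intro k hkb
        by_cases hka : k = a
        · rw [hka, ← hia]; exact hlt
        · exact hother k hka hkb
      · have hib : i = b := by
          by_contra hib
          exact hia (huniq i a hia hib hi.symm).symm
        left
        apply hmax
        rw [memS]
        intro k hka
        by_cases hkb : k = b
        · rw [hkb, ← hib]; exact hlt
        · exact hother k hka hkb
    · rintro (rfl | rfl)
      · exact ⟨hxW a b hab hmab, hxdom a⟩
      · exact ⟨hxW b a hab.symm hmab.symm, hxdom b⟩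
  have hne : x a ≠ x b := by
    intro h
    obtain ⟨i, hi⟩ := hdom (x a)
    have hle := hi _ (hmW i)
    by_cases hia : i = a
    · have := (memS b _).1 (hxS b) i (hia ▸ hab)
      rw [← h] at this
      omega
    · have := (memS a _).1 (hxS a) i hia
      omega
  rw [hpair, Finset.card_pair hne]
  exact even_two

open Classical in
/-- The set of all slack points but one extends to exactly one dominant set. -/
lemma card_dominant_insert_slack (hw : ∀ i, Function.Injective (w i))
    (hmin : ∀ i x, w i (s i) ≤ w i x)
    (hbig : ∀ i j, j ≠ i → ∀ t, t ∉ Set.range s → w i t < w i (s j))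
    (hT : ∃ t, t ∉ Set.range s) (i₀ : I) :
    (Finset.univ.filter fun x => x ∉ (Finset.univ.erase i₀).image s ∧
      IsDominant w (insert x ((Finset.univ.erase i₀).image s))).card = 1 := by
  obtain ⟨t, ht, htmax⟩ := (Finset.univ.filter fun t => t ∉ Set.range s).exists_max_image (w i₀)
    (by obtain ⟨t, ht⟩ := hT; exact ⟨t, by simpa using ht⟩)
  replace ht : t ∉ Set.range s := (Finset.mem_filter.1 ht).2
  replace htmax : ∀ x, x ∉ Set.range s → w i₀ x ≤ w i₀ t := fun x hx =>
    htmax x (Finset.mem_filter.2 ⟨Finset.mem_univ _, hx⟩)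
  have hslack : ∀ i x, x ∉ Set.range s → ¬ w i x ≤ w i (s i) := fun i x hx h =>
    hx ⟨i, hw i (le_antisymm (hmin i x) h)⟩
  rw [Finset.card_eq_one]
  refine ⟨t, ?_⟩
  ext x
  simp only [Finset.mem_filter, Finset.mem_univ, true_and, Finset.mem_singleton]
  constructor
  · rintro ⟨hxW, hx⟩
    have hmem : ∀ i, i ≠ i₀ → s i ∈ insert x ((Finset.univ.erase i₀).image s) := fun i hi =>
      Finset.mem_insert_of_mem (Finset.mem_image_of_mem _ (by simp [hi]))
    have hle : w i₀ t ≤ w i₀ x := by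
      obtain ⟨i, hi⟩ := hx t
      by_cases hii : i = i₀
      · exact hii ▸ hi x (Finset.mem_insert_self _ _)
      · exact absurd (hi _ (hmem i hii)) (hslack i t ht)
    have hxs : x ∉ Set.range s := by
      rintro ⟨k, rfl⟩
      by_cases hk : k = i₀
      · exact hslack i₀ t ht (hk ▸ hle)
      · exact hxW (Finset.mem_image_of_mem _ (by simp [hk]))
    exact hw i₀ (le_antisymm (htmax x hxs) hle)
  · rintro rfl
    refine ⟨fun h => ht ?_, fun y => ?_⟩
    · obtain ⟨k, -, hk⟩ := Finset.mem_image.1 h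
      exact ⟨k, hk⟩
    · by_cases hy : y ∈ Set.range s
      · obtain ⟨k, rfl⟩ := hy
        exact ⟨k, fun u _ => hmin k u⟩
      · refine ⟨i₀, fun u hu => ?_⟩
        rcases Finset.mem_insert.1 hu with rfl | hu
        · exact htmax y hy
        · obtain ⟨k, hk, rfl⟩ := Finset.mem_image.1 hu
          exact (hbig i₀ k (Finset.ne_of_mem_erase hk) y hy).le

/-- **Scarf lemma**: for every labelling there is a dominant set carrying every label exactly
once. -/
theorem exists_dominant_image_eq_univ [Nonempty I] (hw : ∀ i, Function.Injective (w i))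
    (hmin : ∀ i x, w i (s i) ≤ w i x)
    (hbig : ∀ i j, j ≠ i → ∀ t, t ∉ Set.range s → w i t < w i (s j))
    (hT : ∃ t, t ∉ Set.range s) (c : X → I) (hc : ∀ i, c (s i) = i) :
    ∃ U : Finset X, U.card = Fintype.card I ∧ IsDominant w U ∧ U.image c = Finset.univ := by
  classical
  have hs : Function.Injective s := Function.LeftInverse.injective hc
  obtain ⟨i₀⟩ := ‹Nonempty I›
  by_contra! hcon
  let R : Finset (Finset X) :=
    Finset.univ.filter fun U => U.card = Fintype.card I ∧ IsDominant w U
  let D : Finset (Finset X) :=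
    Finset.univ.filter fun W => W.card + 1 = Fintype.card I ∧ W.image c = Finset.univ.erase i₀
  have hcount : ∑ U ∈ R, (U.filter fun u => (U.erase u).image c = Finset.univ.erase i₀).card =
      ∑ W ∈ D, (Finset.univ.filter fun x => x ∉ W ∧ IsDominant w (insert x W)).card := by
    rw [← Finset.card_sigma, ← Finset.card_sigma]
    refine Finset.card_bij' (fun p _ => ⟨p.1.erase p.2, p.2⟩) (fun p _ => ⟨insert p.2 p.1, p.2⟩)
      ?_ ?_ ?_ ?_
    · rintro ⟨U, u⟩ h
      simp only [Finset.mem_sigma, Finset.mem_filter, Finset.mem_univ, true_and, R, D] at h ⊢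
      obtain ⟨⟨h₁, h₂⟩, h₃, h₄⟩ := h
      refine ⟨⟨by rw [Finset.card_erase_add_one h₃, h₁], h₄⟩, Finset.notMem_erase _ _, ?_⟩
      rwa [Finset.insert_erase h₃]
    · rintro ⟨W, x⟩ h
      simp only [Finset.mem_sigma, Finset.mem_filter, Finset.mem_univ, true_and, R, D] at h ⊢
      obtain ⟨⟨h₁, h₂⟩, h₃, h₄⟩ := h
      refine ⟨⟨by rw [Finset.card_insert_of_notMem h₃, h₁], h₄⟩, Finset.mem_insert_self _ _, ?_⟩
      rwa [Finset.erase_insert h₃]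
    · rintro ⟨U, u⟩ h
      simp only [Finset.mem_sigma, Finset.mem_filter] at h
      simp [Finset.insert_erase h.2.1]
    · rintro ⟨W, x⟩ h
      simp only [Finset.mem_sigma, Finset.mem_filter] at h
      simp [Finset.erase_insert h.2.2.1]
  have hR : Even (∑ U ∈ R, (U.filter fun u =>
      (U.erase u).image c = Finset.univ.erase i₀).card) := by
    refine Finset.even_sum _ fun U hU => ?_
    obtain ⟨-, hU, hUd⟩ := Finset.mem_filter.1 hU
    exact even_card_filter_image_erase c i₀ U hU (hcon U hU hUd)
  let W₀ : Finset X := (Finset.univ.erase i₀).image s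
  have hW₀ : W₀ ∈ D := by
    simp only [D, W₀, Finset.mem_filter, Finset.mem_univ, true_and, Finset.image_image]
    constructor
    · rw [Finset.card_image_of_injective _ hs, Finset.card_erase_add_one (Finset.mem_univ _),
        Finset.card_univ]
    · rw [show c ∘ s = id from funext hc, Finset.image_id]
  rw [hcount, ← Finset.add_sum_erase _ _ hW₀, card_dominant_insert_slack hw hmin hbig hT i₀,
    add_comm] at hR
  refine Nat.not_even_iff_odd.2 (Even.add_one ?_) hR
  refine Finset.even_sum _ fun W hW => ?_
  obtain ⟨hne, hW⟩ := Finset.mem_erase.1 hW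
  obtain ⟨-, hcard, hcW⟩ := Finset.mem_filter.1 hW
  have : ∃ t ∈ W, t ∉ Set.range s := by
    by_contra! hall
    refine hne (Finset.Subset.antisymm (fun x hx => ?_) fun x hx => ?_)
    · obtain ⟨k, rfl⟩ := hall x hx
      have := Finset.mem_image_of_mem c hx
      rw [hcW, hc] at this
      exact Finset.mem_image_of_mem _ this
    · obtain ⟨k, hk, rfl⟩ := Finset.mem_image.1 hx
      rw [← hcW] at hk
      obtain ⟨z, hz, hzk⟩ := Finset.mem_image.1 hk
      obtain ⟨l, rfl⟩ := hall z hz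
      rw [hc] at hzk
      exact hzk ▸ hz
  obtain ⟨t₀, ht₀, ht₀s⟩ := this
  exact even_card_dominant_insert hw hs hmin hbig W hcard t₀ ht₀ ht₀s

end Scarf

/-- Given a labelling of the lattice points of a dilated standard simplex, there are lattice points
`z i`, pairwise close, such that `z i` has label `i` unless all the `i`-th coordinates are small. -/
theorem exists_close_labelled_lattice_points {I : Type*} [Fintype I] [Nonempty I] (N : ℕ)
    (c : (I → ℕ) → I) :
    ∃ z : I → I → ℕ, (∀ i, ∑ k, z i k = N) ∧
      (∀ i j k, z i k ≤ z j k + Fintype.card I) ∧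
      ∀ i, c (z i) = i ∨ ∀ j, z j i ≤ Fintype.card I := by
  classical
  let G : Finset (I → ℕ) := Finset.piAntidiag Finset.univ N
  have hG : ∀ t, t ∈ G ↔ ∑ k, t k = N := by simp [G]
  let coord : G ⊕ I → I → ℤ :=
    Sum.elim (fun t i => (t.1 i : ℤ)) (fun j i => if i = j then -1 else N + 1)
  let M : ℕ := Fintype.card (G ⊕ I)
  let e : G ⊕ I ≃ Fin M := Fintype.equivFin _
  let w : I → G ⊕ I → ℤ := fun i x => coord x i * M + (e x : ℕ)
  have hlt : ∀ i x y, coord x i < coord y i → w i x < w i y := by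
    intro i x y h
    have h₁ : ((e x : ℕ) : ℤ) < M := by exact_mod_cast (e x).2
    have h₂ : (0 : ℤ) ≤ (e y : ℕ) := by positivity
    have h₃ : (coord x i + 1) * M ≤ coord y i * M :=
      mul_le_mul_of_nonneg_right (by omega) (by positivity)
    simp only [w]
    linarith
  have hle : ∀ i x y, w i x ≤ w i y → coord x i ≤ coord y i := fun i x y h =>
    not_lt.1 fun h' => (hlt i y x h').not_ge h
  have hw : ∀ i, Function.Injective (w i) := by
    intro i x y h
    have hc : coord x i = coord y i := le_antisymm (hle i x y h.le) (hle i y x h.ge)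
    simp only [w, hc] at h
    exact e.injective (Fin.ext (by exact_mod_cast add_left_cancel h))
  have hcoord_lt : ∀ (t : G) i, coord (Sum.inl t) i < N + 1 := by
    intro t i
    have : t.1 i ≤ ∑ k, t.1 k := Finset.single_le_sum (fun _ _ => Nat.zero_le _) (Finset.mem_univ i)
    rw [(hG _).1 t.2] at this
    simp only [coord, Sum.elim_inl]
    omega
  have hcoord_nonneg : ∀ (t : G) i, 0 ≤ coord (Sum.inl t) i := fun t i => by simp [coord]
  have hmin : ∀ i x, w i (Sum.inr i) ≤ w i x := by
    intro i x
    by_cases hx : x = Sum.inr i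
    · rw [hx]
    · refine (hlt i _ _ ?_).le
      rcases x with t | j
      · have := hcoord_nonneg t i
        simp only [coord, Sum.elim_inr, if_true] at this ⊢
        omega
      · have hij : i ≠ j := fun h => hx (by rw [h])
        simp only [coord, Sum.elim_inr, if_true, if_neg hij]
        omega
  have hbig : ∀ i j, j ≠ i → ∀ t, t ∉ Set.range (Sum.inr : I → G ⊕ I) →
      w i t < w i (Sum.inr j) := by
    intro i j hji t ht
    rcases t with t | k
    · refine hlt i _ _ ((hcoord_lt t i).trans_eq ?_)
      simp [coord, hji.symm]
    · exact absurd ⟨k, rfl⟩ ht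
  have hT : ∃ t, t ∉ Set.range (Sum.inr : I → G ⊕ I) := by
    obtain ⟨i₀⟩ := ‹Nonempty I›
    exact ⟨Sum.inl ⟨Pi.single i₀ N, (hG _).2 (by simp)⟩, by simp⟩
  obtain ⟨U, hU, hdom, hUc⟩ := exists_dominant_image_eq_univ hw hmin hbig hT
    (Sum.elim (fun t => c t.1) id) (fun i => rfl)
  have hUne : U.Nonempty := by
    rw [← Finset.card_pos, hU]
    exact Fintype.card_pos
  have hm : ∀ i, ∃ x ∈ U, ∀ y ∈ U, coord x i ≤ coord y i := fun i =>
    U.exists_min_image (fun x => coord x i) hUne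
  choose m hmU hm using hm
  have hm_ge : ∀ i, -1 ≤ coord (m i) i := by
    intro i
    have := hle i _ _ (hmin i (m i))
    simpa [coord] using this
  have hsum : (N : ℤ) < ∑ i, (coord (m i) i + 1) := by
    by_contra! h
    obtain ⟨i₀⟩ := ‹Nonempty I›
    let r : ℤ := N - ∑ i, (coord (m i) i + 1)
    let t' : I → ℤ := fun i => (coord (m i) i + 1) + (Pi.single i₀ r : I → ℤ) i
    have hr : 0 ≤ (Pi.single i₀ r : I → ℤ) := Pi.single_nonneg.2 (sub_nonneg.2 h)
    have ht' : ∀ i, coord (m i) i + 1 ≤ t' i := fun i => le_add_of_nonneg_right (hr i)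
    have ht'0 : ∀ i, ((t' i).toNat : ℤ) = t' i := fun i =>
      Int.toNat_of_nonneg (by have := ht' i; have := hm_ge i; omega)
    have ht : (fun i => (t' i).toNat) ∈ G := by
      rw [hG]
      zify
      simp only [ht'0, t', Finset.sum_add_distrib (f := fun i => coord (m i) i + 1)]
      simp [r]
    obtain ⟨i, hi⟩ := hdom (Sum.inl ⟨_, ht⟩)
    have h₁ := hle i _ _ (hi _ (hmU i))
    have h₂ := ht' i
    simp only [coord, Sum.elim_inl, ht'0] at h₁ h₂
    omega
  have hclose : ∀ t : G, Sum.inl t ∈ U → ∀ i, (t.1 i : ℤ) < coord (m i) i + Fintype.card I := by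
    intro t ht i
    have h₁ : ∀ k, 0 ≤ (t.1 k : ℤ) - coord (m k) k := fun k => sub_nonneg.2 (hm k _ ht)
    have h₂ := Finset.single_le_sum (f := fun k => (t.1 k : ℤ) - coord (m k) k)
      (fun k _ => h₁ k) (Finset.mem_univ i)
    rw [Finset.sum_sub_distrib] at h₂
    rw [Finset.sum_add_distrib] at hsum
    have h₃ : ∑ k, (t.1 k : ℤ) = N := by exact_mod_cast (hG _).1 t.2
    simp at hsum h₂
    omega
  have hpt : ∃ t : G, Sum.inl t ∈ U := by
    by_contra! hno
    obtain ⟨t, ht⟩ := hT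
    rcases t with t | k
    · obtain ⟨i, hi⟩ := hdom (Sum.inl t)
      have : i ∈ U.image (Sum.elim (fun t : G => c t.1) id) := by rw [hUc]; simp
      obtain ⟨u, hu, hui⟩ := Finset.mem_image.1 this
      rcases u with u | k
      · exact hno u hu
      · have hki : k = i := hui
        have h₁ := hle i _ _ (hi _ hu)
        have h₂ := hcoord_nonneg t i
        simp [coord, hki] at h₁ h₂
        omega
    · exact ht ⟨k, rfl⟩
  obtain ⟨t₀, ht₀⟩ := hpt
  have hz : ∀ i, ∃ t : G, Sum.inl t ∈ U ∧ (c t.1 = i ∨ Sum.inr i ∈ U) := by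
    intro i
    have : i ∈ U.image (Sum.elim (fun t : G => c t.1) id) := by rw [hUc]; simp
    obtain ⟨u, hu, hui⟩ := Finset.mem_image.1 this
    rcases u with u | k
    · exact ⟨u, hu, Or.inl hui⟩
    · have hki : k = i := hui
      exact ⟨t₀, ht₀, Or.inr (hki ▸ hu)⟩
  choose z hzU hz using hz
  refine ⟨fun i => (z i).1, fun i => (hG _).1 (z i).2, fun i j k => ?_, fun i => ?_⟩
  · have h₁ := hclose _ (hzU i) k
    have h₂ := hm k _ (hzU j)
    simp only [coord, Sum.elim_inl] at h₁ h₂ ⊢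
    omega
  · refine (hz i).imp id fun h j => ?_
    have h₁ := hclose _ (hzU j) i
    have h₂ := hm i _ h
    simp only [coord, Sum.elim_inr, if_true] at h₁ h₂ ⊢
    omega

/-- A variational inequality on the standard simplex: continuous payoffs admit a point of the
simplex at which no payoff exceeds the average one. -/
theorem exists_forall_le_sum_mul {I : Type*} [Fintype I] [Nonempty I] (φ : I → (I → ℝ) → ℝ)
    (hφ : ∀ i, ContinuousOn (φ i) (stdSimplex ℝ I)) :
    ∃ x ∈ stdSimplex ℝ I, ∀ i, φ i x ≤ ∑ j, x j * φ j x := by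
  have hmax : ∀ x : I → ℝ, ∃ i, ∀ j, φ j x ≤ φ i x := fun x => by
    obtain ⟨i, -, hi⟩ := Finset.univ.exists_max_image (fun i => φ i x) Finset.univ_nonempty
    exact ⟨i, fun j => hi j (Finset.mem_univ j)⟩
  choose lab hlab using hmax
  let scale : ℕ → (I → ℕ) → I → ℝ := fun N t i => (t i : ℝ) / (N + 1)
  choose z hzsum hzclose hz using fun N : ℕ =>
    exists_close_labelled_lattice_points (N + 1) fun t => lab (scale N t)
  let p : ℕ → I → I → ℝ := fun N i => scale N (z N i)
  have hpos : ∀ N : ℕ, (0 : ℝ) < N + 1 := fun N => by positivity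
  have hp : ∀ N i, p N i ∈ stdSimplex ℝ I := by
    intro N i
    refine ⟨fun k => by simp only [p, scale]; positivity, ?_⟩
    simp only [p, scale]
    rw [← Finset.sum_div, div_eq_one_iff_eq (hpos N).ne']
    exact_mod_cast hzsum N i
  let ε : ℕ → ℝ := fun N => Fintype.card I / ((N : ℝ) + 1)
  have hclose : ∀ N i j k, p N i k ≤ p N j k + ε N := by
    intro N i j k
    simp only [p, scale, ε]
    rw [← add_div]
    exact div_le_div_of_nonneg_right (by exact_mod_cast hzclose N i j k) (hpos N).le
  let u : Ultrafilter ℕ := Filter.hyperfilter ℕ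
  have hu : (u : Filter ℕ) ≤ Filter.atTop := by
    rw [← Nat.cofinite_eq_atTop]
    exact Filter.hyperfilter_le_cofinite
  have hε : Filter.Tendsto ε u (nhds 0) :=
    (tendsto_const_div_atTop_nhds_zero_nat (Fintype.card I : ℝ)).comp
      (Filter.tendsto_add_atTop_nat 1) |>.mono_left hu |>.congr fun N => by simp [ε]
  have hlim : ∀ i, ∃ x ∈ stdSimplex ℝ I, Filter.Tendsto (fun N => p N i) u (nhds x) := by
    intro i
    obtain ⟨x, hx, h⟩ := (isCompact_stdSimplex (𝕜 := ℝ) (ι := I)).ultrafilter_le_nhds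
      (u.map fun N => p N i)
      (Filter.le_principal_iff.2 (Filter.mem_map.2 (Filter.Eventually.of_forall fun N => hp N i)))
    exact ⟨x, hx, h⟩
  choose x hx hlim using hlim
  have hxle : ∀ i j, x i ≤ x j := by
    intro i j k
    have h₁ := tendsto_pi_nhds.1 (hlim i) k
    have h₂ := (tendsto_pi_nhds.1 (hlim j) k).add hε
    rw [add_zero] at h₂
    exact le_of_tendsto_of_tendsto' h₁ h₂ fun N => hclose N i j k
  obtain ⟨i₀⟩ := ‹Nonempty I›
  have hxeq : ∀ i, x i = x i₀ := fun i => le_antisymm (hxle _ _) (hxle _ _)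
  have hφlim : ∀ i j, Filter.Tendsto (fun N => φ j (p N i)) u (nhds (φ j (x i₀))) := by
    intro i j
    refine (hφ j (x i₀) (hx i₀)).tendsto.comp (tendsto_nhdsWithin_iff.2 ⟨hxeq i ▸ hlim i, ?_⟩)
    exact Filter.Eventually.of_forall fun N => hp N i
  have hdich : ∀ i, (∀ j, φ j (x i₀) ≤ φ i (x i₀)) ∨ x i₀ i = 0 := by
    intro i
    have : ∀ᶠ N in (u : Filter ℕ), lab (p N i) = i ∨ ∀ j, p N j i ≤ ε N := by
      refine Filter.Eventually.of_forall fun N => (hz N i).imp id fun h j => ?_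
      exact div_le_div_of_nonneg_right (by exact_mod_cast h j) (hpos N).le
    rcases Ultrafilter.eventually_or.1 this with h | h
    · left
      intro j
      refine le_of_tendsto_of_tendsto (hφlim i j) (hφlim i i) (h.mono fun N hN => ?_)
      have := hlab (p N i) j
      rwa [hN] at this
    · right
      refine le_antisymm ?_ ((hx i₀).1 i)
      exact le_of_tendsto_of_tendsto (tendsto_pi_nhds.1 (hlim i₀) i) hε (h.mono fun N hN => hN i₀)
  refine ⟨x i₀, hx i₀, fun i => ?_⟩
  calc φ i (x i₀) = ∑ j, x i₀ j * φ i (x i₀) := by rw [← Finset.sum_mul, (hx i₀).2, one_mul]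
    _ ≤ ∑ j, x i₀ j * φ j (x i₀) := Finset.sum_le_sum fun j _ => by
      rcases hdich j with h | h
      · exact mul_le_mul_of_nonneg_left (h i) ((hx i₀).1 j)
      · simp [h]

namespace Geometry.SimplicialComplex

variable {E : Type*}

/-- The weights of convex combinations of the vertices in `s`. -/
def weights (s : Finset E) : Set (E → ℝ) :=
  {a | (∀ v, 0 ≤ a v) ∧ (∀ v, v ∉ s → a v = 0) ∧ ∑ v ∈ s, a v = 1}

lemma isCompact_weights (s : Finset E) : IsCompact (weights s) := by
  refine (isCompact_univ_pi fun _ : E => isCompact_Icc (a := (0 : ℝ)) (b := 1)).of_isClosed_subset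
    ?_ fun a ha v _ => ⟨ha.1 v, ?_⟩
  · refine IsClosed.and ?_ (IsClosed.and ?_ ?_)
    · simp only [Set.ofPred_forall]
      exact isClosed_iInter fun v => isClosed_le continuous_const (continuous_apply v)
    · simp only [Set.ofPred_forall]
      exact isClosed_iInter fun v => isClosed_iInter fun _ =>
        isClosed_eq (continuous_apply v) continuous_const
    · exact isClosed_eq (by fun_prop) continuous_const
  · by_cases hv : v ∈ s
    · exact (Finset.single_le_sum (fun w _ => ha.1 w) hv).trans_eq ha.2.2
    · rw [ha.2.1 v hv]
      exact zero_le_one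

lemma weights_mono {s t : Finset E} (hst : s ⊆ t) : weights s ⊆ weights t := fun _ ha =>
  ⟨ha.1, fun v hv => ha.2.1 v fun h => hv (hst h), by
    rw [← ha.2.2]
    exact (Finset.sum_subset hst fun v _ hv => ha.2.1 v hv).symm⟩

lemma sum_smul_eq_of_subset {F : Type*} [AddCommGroup F] [Module ℝ F] {s t : Finset E}
    (hst : s ⊆ t) {a : E → ℝ} (ha : a ∈ weights s) (g : E → F) :
    ∑ v ∈ t, a v • g v = ∑ v ∈ s, a v • g v :=
  (Finset.sum_subset hst fun v _ hv => by rw [ha.2.1 v hv, zero_smul]).symm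

lemma sum_smul_mem_convexHull {F : Type*} [AddCommGroup F] [Module ℝ F] {s : Finset E}
    {a : E → ℝ} (ha : a ∈ weights s) (g : E → F) :
    ∑ v ∈ s, a v • g v ∈ convexHull ℝ (g '' s) :=
  (convex_convexHull ℝ _).sum_mem (fun v _ => ha.1 v) ha.2.2 fun _ hv =>
    subset_convexHull ℝ _ (Set.mem_image_of_mem g hv)

variable [AddCommGroup E] [Module ℝ E]

/-- Barycentric coordinates with respect to a face of a simplicial complex are unique. -/
lemma weights_eq_of_mem_faces (K : SimplicialComplex ℝ E) {s : Finset E} (hs : s ∈ K.faces)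
    {a b : E → ℝ} (ha : ∀ v, v ∉ s → a v = 0) (hb : ∀ v, v ∉ s → b v = 0)
    (hsum : ∑ v ∈ s, a v = ∑ v ∈ s, b v) (h : ∑ v ∈ s, a v • v = ∑ v ∈ s, b v • v) : a = b := by
  have key := affineIndependent_iff.1 (K.indep hs) s.attach (fun v => a v - b v)
    (by rw [Finset.sum_attach s fun v => a v - b v, Finset.sum_sub_distrib, hsum, sub_self])
    (by rw [Finset.sum_attach s fun v => (a v - b v) • v]
        simp only [sub_smul]
        rw [Finset.sum_sub_distrib, h, sub_self])
  ext v
  by_cases hv : v ∈ s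
  · exact sub_eq_zero.1 (key ⟨v, hv⟩ (Finset.mem_attach _ _))
  · rw [ha v hv, hb v hv]

lemma exists_weights_of_mem_convexHull {s : Finset E} {x : E}
    (hx : x ∈ convexHull ℝ (s : Set E)) : ∃ a ∈ weights s, ∑ v ∈ s, a v • v = x := by
  classical
  obtain ⟨a, ha, hsum, rfl⟩ := Finset.mem_convexHull'.1 hx
  refine ⟨fun v => if v ∈ s then a v else 0, ⟨fun v => ?_, fun v hv => if_neg hv, ?_⟩, ?_⟩
  · dsimp only
    split_ifs with hv
    exacts [ha v hv, le_rfl]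
  · rw [← hsum]
    exact Finset.sum_congr rfl fun v hv => if_pos hv
  · exact Finset.sum_congr rfl fun v hv => by simp only [if_pos hv]

/-- Barycentric coordinates with respect to a simplicial complex are unique. -/
lemma weights_unique (K : SimplicialComplex ℝ E) {s t : Finset E} (hs : s ∈ K.faces)
    (ht : t ∈ K.faces) {a b : E → ℝ} (ha : a ∈ weights s) (hb : b ∈ weights t)
    (h : ∑ v ∈ s, a v • v = ∑ v ∈ t, b v • v) : a = b := by
  classical
  have hxs := sum_smul_mem_convexHull ha id
  have hxt := sum_smul_mem_convexHull hb id
  simp only [id, Set.image_id'] at hxs hxt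
  have hx := K.inter_subset_convexHull hs ht ⟨hxs, h ▸ hxt⟩
  rw [← Finset.coe_inter] at hx
  obtain ⟨d, hd, hdx⟩ := exists_weights_of_mem_convexHull hx
  have hds := weights_mono Finset.inter_subset_left hd
  have hdt := weights_mono Finset.inter_subset_right hd
  have h₁ : a = d := K.weights_eq_of_mem_faces hs ha.2.1 hds.2.1 (ha.2.2.trans hds.2.2.symm)
    (by rw [sum_smul_eq_of_subset Finset.inter_subset_left hd fun v => v, hdx])
  have h₂ : b = d := K.weights_eq_of_mem_faces ht hb.2.1 hdt.2.1 (hb.2.2.trans hdt.2.2.symm)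
    (by rw [sum_smul_eq_of_subset Finset.inter_subset_right hd fun v => v, hdx, h])
  rw [h₁, h₂]

/-- A map on the vertices of a finite simplicial complex extends to a continuous map on the
underlying space which is affine on each face. -/
theorem exists_continuousOn_extension [TopologicalSpace E] [T2Space E] [ContinuousAdd E]
    [ContinuousSMul ℝ E] {F : Type*} [AddCommGroup F] [Module ℝ F] [TopologicalSpace F]
    [ContinuousAdd F] [ContinuousSMul ℝ F] (K : SimplicialComplex ℝ E) (hK : K.faces.Finite)
    (g : E → F) :
    ∃ Φ : E → F, ContinuousOn Φ K.space ∧ ∀ x ∈ K.space, ∃ s ∈ K.faces, ∃ a ∈ weights s,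
      ∑ v ∈ s, a v • v = x ∧ ∑ v ∈ s, a v • g v = Φ x := by
  classical
  let V : Finset E := hK.toFinset.biUnion id
  have hV : ∀ s ∈ K.faces, s ⊆ V := fun s hs =>
    Finset.subset_biUnion_of_mem id (hK.mem_toFinset.2 hs)
  let Z : Set (E → ℝ) := ⋃ s ∈ K.faces, weights s
  have hZ : ∀ a, a ∈ Z ↔ ∃ s ∈ K.faces, a ∈ weights s := fun a => by simp [Z]
  have : CompactSpace Z :=
    isCompact_iff_compactSpace.1 (hK.isCompact_biUnion fun s _ => isCompact_weights s)
  let A : Z → K.space := fun a => ⟨∑ v ∈ V, a.1 v • v, by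
    obtain ⟨s, hs, ha⟩ := (hZ _).1 a.2
    rw [sum_smul_eq_of_subset (hV s hs) ha fun v => v]
    refine K.convexHull_subset_space hs ?_
    simpa using sum_smul_mem_convexHull ha id⟩
  have hA : Continuous A := by
    refine Continuous.subtype_mk (continuous_finsetSum _ fun v _ => ?_) _
    exact ((continuous_apply v).comp continuous_subtype_val).smul continuous_const
  have hbij : Function.Bijective A := by
    constructor
    · rintro ⟨a, ha⟩ ⟨b, hb⟩ hab
      obtain ⟨s, hs, has⟩ := (hZ _).1 ha
      obtain ⟨t, ht, hbt⟩ := (hZ _).1 hb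
      have hab' := congrArg Subtype.val hab
      simp only [A] at hab'
      rw [sum_smul_eq_of_subset (hV s hs) has fun v => v,
        sum_smul_eq_of_subset (hV t ht) hbt fun v => v] at hab'
      exact Subtype.ext (K.weights_unique hs ht has hbt hab')
    · rintro ⟨x, hx⟩
      obtain ⟨s, hs, hxs⟩ := mem_space_iff.1 hx
      obtain ⟨a, ha, hax⟩ := exists_weights_of_mem_convexHull hxs
      refine ⟨⟨a, (hZ _).2 ⟨s, hs, ha⟩⟩, Subtype.ext ?_⟩
      simp only [A]
      rw [sum_smul_eq_of_subset (hV s hs) ha fun v => v, hax]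
  let e : Z ≃ K.space := Equiv.ofBijective A hbij
  have he : Continuous e.symm := Continuous.continuous_symm_of_equiv_compact_to_t2 (f := e) hA
  refine ⟨fun x => if h : x ∈ K.space then ∑ v ∈ V, (e.symm ⟨x, h⟩).1 v • g v else 0, ?_, ?_⟩
  · rw [continuousOn_iff_continuous_domRestrict]
    have : Continuous fun x : K.space => ∑ v ∈ V, (e.symm x).1 v • g v :=
      continuous_finsetSum _ fun v _ =>
        ((continuous_apply v).comp (continuous_subtype_val.comp he)).smul continuous_const
    refine this.congr fun x => ?_
    simp
  · intro x hx
    obtain ⟨s, hs, ha⟩ := (hZ _).1 (e.symm ⟨x, hx⟩).2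
    refine ⟨s, hs, _, ha, ?_, ?_⟩
    · have := congrArg Subtype.val (e.apply_symm_apply ⟨x, hx⟩)
      rw [← sum_smul_eq_of_subset (hV s hs) ha fun v => v]
      exact this
    · simp only [dif_pos hx]
      rw [sum_smul_eq_of_subset (hV s hs) ha g]

end Geometry.SimplicialComplex

/-- A continuous self-map of a polytope which maps every exposed face into itself attains every
point of the polytope. -/
theorem exists_eq_of_forall_isExposed_mapsTo {k : ℕ} (V : Finset (Fin k → ℝ))
    (F : (Fin k → ℝ) → Fin k → ℝ) (hF : ContinuousOn F (convexHull ℝ (V : Set (Fin k → ℝ))))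
    (hface : ∀ σ, IsExposed ℝ (convexHull ℝ (V : Set (Fin k → ℝ))) σ → Set.MapsTo F σ σ)
    (p : Fin k → ℝ) (hp : p ∈ convexHull ℝ (V : Set (Fin k → ℝ))) :
    ∃ x ∈ convexHull ℝ (V : Set (Fin k → ℝ)), F x = p := by
  have : Nonempty V := by
    obtain ⟨v, hv⟩ := convexHull_nonempty_iff.1 ⟨p, hp⟩
    exact ⟨⟨v, hv⟩⟩
  let A : (V → ℝ) → Fin k → ℝ := fun a => ∑ v, a v • (v : Fin k → ℝ)
  have hA : Continuous A := by fun_prop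
  have hAmem : Set.MapsTo A (stdSimplex ℝ V) (convexHull ℝ (V : Set (Fin k → ℝ))) := fun a ha =>
    (convex_convexHull ℝ _).sum_mem (fun v _ => ha.1 v) ha.2 fun v _ =>
      subset_convexHull ℝ _ v.2
  obtain ⟨a, ha, hav⟩ := exists_forall_le_sum_mul
    (fun (v : V) a => dotProduct (p - F (A a)) (v : Fin k → ℝ)) fun v => by
      have : ContinuousOn (fun a => F (A a)) (stdSimplex ℝ V) := hF.comp hA.continuousOn hAmem
      refine continuousOn_finsetSum _ fun i _ => ContinuousOn.mul ?_ continuousOn_const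
      exact (continuous_apply i).comp_continuousOn (continuousOn_const.sub this)
  let l : StrongDual ℝ (Fin k → ℝ) :=
    LinearMap.toContinuousLinearMap (dotProductBilin ℝ ℝ (p - F (A a)))
  have hl : ∀ x, l x = dotProduct (p - F (A a)) x := fun x => rfl
  have hlA : ∀ v ∈ V, l v ≤ l (A a) := fun v hv => by
    have h₁ := hav ⟨v, hv⟩
    have h₂ : l (A a) = ∑ j, a j * l j := by simp only [A, map_sum, map_smul, smul_eq_mul]
    rw [h₂]
    exact h₁
  have hlP : ∀ x ∈ convexHull ℝ (V : Set (Fin k → ℝ)), l x ≤ l (A a) := fun x hx =>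
    convexHull_min (t := {x | l x ≤ l (A a)}) hlA
      (convex_halfSpace_le l.toLinearMap.isLinear _) hx
  have hmem : F (A a) ∈ {x ∈ convexHull ℝ (V : Set (Fin k → ℝ)) |
      ∀ y ∈ convexHull ℝ (V : Set (Fin k → ℝ)), l y ≤ l x} :=
    hface _ (fun _ => ⟨l, rfl⟩) ⟨hAmem ha, hlP⟩
  refine ⟨A a, hAmem ha, ?_⟩
  have h₁ : l (p - F (A a)) ≤ 0 := by
    rw [map_sub]
    exact sub_nonpos.2 (hmem.2 p hp)
  rw [hl] at h₁
  have h₂ : p - F (A a) = 0 := dotProduct_self_eq_zero.1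
    (le_antisymm h₁ (Finset.sum_nonneg fun i _ => mul_self_nonneg _))
  exact (sub_eq_zero.1 h₂).symm


/-- **Polytopal Sperner–Shapley theorem** (Frick–Zerbib, Theorem 2.2).
Let `T` be a (finite, geometric) triangulation of a polytope `P ⊆ ℝ^k`, and let
`f` be a Sperner–Shapley labeling of `T`: each vertex `v` of `T` is labeled by a
nonempty (exposed) face `f v` of `P` with `f v ⊆ supp v`, i.e. `f v ⊆ σ` for every
face `σ` of `P` containing `v`. For every nonempty face `σ` of `P` choose a point
`y σ ∈ σ`. Then there is a face `τ` of `T` such that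
`y P ∈ conv {y (f v) : v a vertex of τ}`. -/
theorem polytopal_sperner_shapley (k : ℕ) (V : Finset (Fin k → ℝ)) (P : Set (Fin k → ℝ))
    (hP : P = convexHull ℝ (V : Set (Fin k → ℝ)))
    (hPne : P.Nonempty)
    (T : Geometry.SimplicialComplex ℝ (Fin k → ℝ))
    (hTfin : T.faces.Finite)
    (hTspace : T.space = P)
    (f : (Fin k → ℝ) → Set (Fin k → ℝ))
    (hface : ∀ v ∈ T.vertices, IsExposed ℝ P (f v) ∧ (f v).Nonempty)
    (hlabel : ∀ v ∈ T.vertices, ∀ σ, IsExposed ℝ P σ → σ.Nonempty → v ∈ σ → f v ⊆ σ)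
    (y : Set (Fin k → ℝ) → Fin k → ℝ)
    (hy : ∀ σ, IsExposed ℝ P σ → σ.Nonempty → y σ ∈ σ) :
    ∃ τ ∈ T.faces, y P ∈ convexHull ℝ ((fun v => y (f v)) '' ↑τ) := by
  subst hP
  obtain ⟨F, hF, hFx⟩ := T.exists_continuousOn_extension hTfin fun v => y (f v)
  rw [hTspace] at hF hFx
  have hyP : y (convexHull ℝ (V : Set (Fin k → ℝ))) ∈ convexHull ℝ (V : Set (Fin k → ℝ)) :=
    hy _ (IsExposed.refl _) hPne
  have hFface : ∀ σ, IsExposed ℝ (convexHull ℝ (V : Set (Fin k → ℝ))) σ → Set.MapsTo F σ σ := by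
    intro σ hσ x hxσ
    obtain ⟨l, hl⟩ := hσ ⟨x, hxσ⟩
    have hxl := hl ▸ hxσ
    obtain ⟨s, hs, a, ha, hax, haF⟩ := hFx x (hσ.subset hxσ)
    have hsP : ∀ v ∈ s, v ∈ convexHull ℝ (V : Set (Fin k → ℝ)) := fun v hv =>
      hTspace ▸ T.subset_space hs hv
    have hzero : ∑ v ∈ s, a v * (l x - l v) = 0 := by
      simp only [mul_sub, Finset.sum_sub_distrib, ← Finset.sum_mul, ha.2.2]
      rw [← hax]
      simp [map_sum]
    have hvσ : ∀ v ∈ s, a v ≠ 0 → v ∈ σ := by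
      intro v hv hav
      have h₁ := (Finset.sum_eq_zero_iff_of_nonneg fun w hw =>
        mul_nonneg (ha.1 w) (sub_nonneg.2 (hxl.2 w (hsP w hw)))).1 hzero v hv
      have h₂ : l x = l v := sub_eq_zero.1 ((mul_eq_zero.1 h₁).resolve_left hav)
      rw [hl]
      exact ⟨hsP v hv, fun z hz => h₂ ▸ hxl.2 z hz⟩
    rw [← haF, ← Finset.sum_filter_of_ne (p := fun v => a v ≠ 0)
      fun v _ h hav => h (by rw [hav, zero_smul])]
    refine (hσ.convex (convex_convexHull ℝ _)).sum_mem (fun v _ => ha.1 v)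
      (by rw [Finset.sum_filter_ne_zero, ha.2.2]) fun v hv => ?_
    obtain ⟨hvs, hav⟩ := Finset.mem_filter.1 hv
    have hvT : v ∈ T.vertices := T.down_closed hs (by simpa using hvs) (by simp)
    obtain ⟨hfe, hfn⟩ := hface v hvT
    exact hlabel v hvT σ hσ ⟨x, hxσ⟩ (hvσ v hvs hav) (hy _ hfe hfn)
  obtain ⟨x, hx, hxp⟩ := exists_eq_of_forall_isExposed_mapsTo V F hF hFface _ hyP
  obtain ⟨s, hs, a, ha, -, hax⟩ := hFx x hx
  refine ⟨s, hs, ?_⟩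
  rw [← hxp, ← hax]
  exact Geometry.SimplicialComplex.sum_smul_mem_convexHull ha _
end

section
/- Let X_1, …, X_{k+1} be finite subsets of ℝ^k such that 0 ∈ conv(X_i) for every i ∈ [k+1]. Then there exist points x_1 ∈ X_1, …, x_{k+1} ∈ X_{k+1} such that 0 ∈ conv{x_1, …, x_{k+1}}. -/
open scoped RealInnerProductSpace

section

variable {E : Type*} [NormedAddCommGroup E] [InnerProductSpace ℝ E]

/-- A minimal-norm point `p` of a convex set satisfies `‖p‖ ^ 2 ≤ ⟪p, q⟫` on that set. -/
theorem Convex.norm_sq_le_inner_of_norm_le {C : Set E} (hC : Convex ℝ C) {p : E} (hp : p ∈ C)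
    (hmin : ∀ q ∈ C, ‖p‖ ≤ ‖q‖) {q : E} (hq : q ∈ C) : ‖p‖ ^ 2 ≤ ⟪p, q⟫ := by
  have : Nonempty C := ⟨⟨p, hp⟩⟩
  have hinf : ‖0 - p‖ = ⨅ w : C, ‖0 - (w : E)‖ := by
    simp only [zero_sub, norm_neg]
    exact le_antisymm (le_ciInf fun w => hmin w w.2)
      (ciInf_le (f := fun w : C => ‖(w : E)‖)
        ⟨0, by rintro _ ⟨w, rfl⟩; exact norm_nonneg _⟩ ⟨p, hp⟩)
  have h := (norm_eq_iInf_iff_real_inner_le_zero hC hp).1 hinf q hq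
  rw [zero_sub, inner_neg_left, inner_sub_right, real_inner_self_eq_norm_sq] at h
  linarith

/-- An affinely independent family in an affine hyperplane avoiding the origin is linearly
independent. -/
theorem AffineIndependent.linearIndependent_of_inner_eq {ι : Type*} {z : ι → E}
    (hz : AffineIndependent ℝ z) {p : E} {c : ℝ} (hc : c ≠ 0) (h : ∀ i, ⟪p, z i⟫ = c) :
    LinearIndependent ℝ z := by
  rw [linearIndependent_iff']
  intro s g hg
  have hsum : ∑ i ∈ s, g i = 0 := by
    have := congrArg (fun v => ⟪p, v⟫) hg
    simp only [inner_sum, inner_smul_right, h, inner_zero_right, ← Finset.sum_mul] at this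
    exact (mul_eq_zero.1 this).resolve_right hc
  exact affineIndependent_iff.1 hz s g hsum hg

/-- If `0` lies in the convex hull of `s`, then every closed half-space bounded by a hyperplane
through the origin meets `s`. -/
theorem exists_inner_nonpos_of_zero_mem_convexHull {s : Set E} (hs : (0 : E) ∈ convexHull ℝ s)
    (p : E) : ∃ y ∈ s, ⟪p, y⟫ ≤ 0 := by
  by_contra! h
  have hsub : convexHull ℝ s ⊆ {y | 0 < ⟪p, y⟫} :=
    convexHull_min h (convex_halfSpace_gt (innerₗ E p).isLinear 0)
  simpa using hsub hs

/-- A point of minimal norm in the convex hull of more than `finrank ℝ E` points is, if nonzero,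
in the convex hull of the family with one of its points removed. -/
theorem exists_mem_convexHull_image_compl_singleton [FiniteDimensional ℝ E] {ι : Type*} [Fintype ι]
    (hι : Module.finrank ℝ E < Fintype.card ι) {x : ι → E} {p : E} (hp0 : p ≠ 0)
    (hp : p ∈ convexHull ℝ (Set.range x))
    (hmin : ∀ q ∈ convexHull ℝ (Set.range x), ‖p‖ ≤ ‖q‖) :
    ∃ j, p ∈ convexHull ℝ (x '' {j}ᶜ) := by
  obtain ⟨κ, _, z, w, hzx, hz, hw, hw1, hwz⟩ := eq_pos_convex_span_of_mem_convexHull hp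
  have hle (i : κ) : ‖p‖ ^ 2 ≤ ⟪p, z i⟫ :=
    (convex_convexHull ℝ _).norm_sq_le_inner_of_norm_le hp hmin
      (subset_convexHull ℝ _ (hzx ⟨i, rfl⟩))
  have hinner (i : κ) : ⟪p, z i⟫ = ‖p‖ ^ 2 := by
    have hsum : ∑ i, w i * (⟪p, z i⟫ - ‖p‖ ^ 2) = 0 := by
      simp only [mul_sub, Finset.sum_sub_distrib, ← Finset.sum_mul, hw1, ← inner_smul_right,
        ← inner_sum, hwz, real_inner_self_eq_norm_sq, one_mul, sub_self]
    have := (Finset.sum_eq_zero_iff_of_nonneg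
      fun i _ => mul_nonneg (hw i).le (sub_nonneg.2 (hle i))).1 hsum i (Finset.mem_univ i)
    exact sub_eq_zero.1 ((mul_eq_zero.1 this).resolve_left (hw i).ne')
  have hcard : Fintype.card κ < Fintype.card ι :=
    (hz.linearIndependent_of_inner_eq (pow_ne_zero 2 (norm_ne_zero_iff.2 hp0))
      hinner).fintype_card_le_finrank.trans_lt hι
  choose f hf using fun i => hzx (Set.mem_range_self i)
  have hsurj : ¬ Function.Surjective f := fun h =>
    hcard.not_ge (Fintype.card_le_of_surjective f h)
  obtain ⟨j, hj⟩ := not_forall.1 hsurj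
  refine ⟨j, hwz ▸ (convex_convexHull ℝ _).sum_mem (fun i _ => (hw i).le) hw1 fun i _ =>
    subset_convexHull ℝ _ ⟨f i, fun h => hj ⟨i, h⟩, hf i⟩⟩

/-- **Colorful Carathéodory theorem** in a finite-dimensional inner product space. -/
theorem exists_zero_mem_convexHull_range_of_forall_zero_mem_convexHull [FiniteDimensional ℝ E]
    {ι : Type*} [Fintype ι] (hι : Module.finrank ℝ E < Fintype.card ι) {X : ι → Set E}
    (hfin : ∀ i, (X i).Finite) (hX : ∀ i, (0 : E) ∈ convexHull ℝ (X i)) :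
    ∃ x : ι → E, (∀ i, x i ∈ X i) ∧ (0 : E) ∈ convexHull ℝ (Set.range x) := by
  classical
  have hne (i : ι) : (X i).Nonempty := convexHull_nonempty_iff.1 ⟨0, hX i⟩
  choose x₀ hx₀ using hne
  have : Nonempty ι := Fintype.card_pos_iff.1 (by lia)
  have hcompact : IsCompact (⋃ x ∈ Set.univ.pi X, convexHull ℝ (Set.range x)) :=
    (Set.Finite.pi hfin).isCompact_biUnion
      fun x _ => (Set.finite_range x).isCompact_convexHull ℝ
  have hnonempty : (⋃ x ∈ Set.univ.pi X, convexHull ℝ (Set.range x)).Nonempty :=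
    ⟨x₀ (Classical.arbitrary ι), Set.mem_biUnion (fun i _ => hx₀ i)
      (subset_convexHull ℝ _ (Set.mem_range_self _))⟩
  obtain ⟨p, hp, hmin⟩ := hcompact.exists_isMinOn hnonempty continuous_norm.continuousOn
  have hmin' (x : ι → E) (hx : ∀ i, x i ∈ X i) (q : E) (hq : q ∈ convexHull ℝ (Set.range x)) :
      ‖p‖ ≤ ‖q‖ := hmin (Set.mem_biUnion (fun i _ => hx i) hq)
  obtain ⟨x, hx, hpx⟩ := Set.mem_iUnion₂.1 hp
  replace hx (i : ι) : x i ∈ X i := hx i trivial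
  rcases eq_or_ne p 0 with rfl | hp0
  · exact ⟨x, hx, hpx⟩
  obtain ⟨j, hj⟩ := exists_mem_convexHull_image_compl_singleton hι hp0 hpx (hmin' x hx)
  obtain ⟨y, hy, hpy⟩ := exists_inner_nonpos_of_zero_mem_convexHull (hX j) p
  have hupd (i : ι) : Function.update x j y i ∈ X i := by
    rcases eq_or_ne i j with rfl | hij
    · simpa using hy
    · simpa [hij] using hx i
  have hsub : x '' {j}ᶜ ⊆ Set.range (Function.update x j y) := by
    rintro _ ⟨i, hi, rfl⟩
    exact ⟨i, Function.update_of_ne hi _ _⟩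
  have hle : ‖p‖ ^ 2 ≤ ⟪p, y⟫ :=
    (convex_convexHull ℝ _).norm_sq_le_inner_of_norm_le (convexHull_mono hsub hj)
      (hmin' _ hupd) (subset_convexHull ℝ _ ⟨j, Function.update_self _ _ _⟩)
  exact absurd (hle.trans hpy) (not_le.2 (pow_pos (norm_pos_iff.2 hp0) 2))

end

/-- **Bárány's colorful Carathéodory theorem.** If `X 1, …, X (k+1)` are finite subsets
of `ℝ^k` each of whose convex hulls contains the origin, then one can pick `x i ∈ X i`
for each `i` such that `0 ∈ conv {x 1, …, x (k+1)}`. -/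
theorem colorful_caratheodory (k : ℕ) (X : Fin (k + 1) → Finset (Fin k → ℝ))
    (hX : ∀ i, (0 : Fin k → ℝ) ∈ convexHull ℝ (X i : Set (Fin k → ℝ))) :
    ∃ x : Fin (k + 1) → Fin k → ℝ, (∀ i, x i ∈ X i) ∧
      (0 : Fin k → ℝ) ∈ convexHull ℝ (Set.range x) := by
  let e : EuclideanSpace ℝ (Fin k) ≃ₗ[ℝ] (Fin k → ℝ) := WithLp.linearEquiv 2 ℝ (Fin k → ℝ)
  obtain ⟨x, hx, h0⟩ := exists_zero_mem_convexHull_range_of_forall_zero_mem_convexHull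
    (E := EuclideanSpace ℝ (Fin k)) (by simp)
    (X := fun i => e.symm '' (X i : Set (Fin k → ℝ))) (fun i => (X i).finite_toSet.image _)
    fun i => by
      have := e.symm.toLinearMap.image_convexHull (X i : Set (Fin k → ℝ))
      exact this ▸ ⟨0, hX i, map_zero e.symm⟩
  refine ⟨fun i => e (x i), fun i => ?_, ?_⟩
  · obtain ⟨y, hy, hyx⟩ := hx i
    simpa [← hyx] using hy
  · have := e.toLinearMap.image_convexHull (Set.range x)
    rw [← Set.range_comp] at this
    exact this ▸ ⟨0, h0, map_zero e⟩
end

section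
/- Let {A_T : T a nonempty subset of [k+1]} be a family of closed subsets of the standard k-simplex Δ_k such that Δ^S ⊆ ⋃_{T ⊆ S, T ≠ ∅} A_T for every nonempty S ⊆ [k+1] (a KKMS cover). Then there exists a balanced collection T_1, …, T_m of nonempty subsets of [k+1] such that ⋂_{i=1}^m A_{T_i} ≠ ∅. -/
/-- The face `Δ^S` of the standard simplex spanned by the vertices in `S`. -/
def simplexFace (k : ℕ) (S : Finset (Fin (k + 1))) : Set (Fin (k + 1) → ℝ) :=
  {x ∈ stdSimplex ℝ (Fin (k + 1)) | ∀ i ∉ S, x i = 0}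

/-- The barycenter of the face `Δ^S` of the standard simplex. -/
noncomputable def faceBarycenter (k : ℕ) (S : Finset (Fin (k + 1))) : Fin (k + 1) → ℝ :=
  fun i => if i ∈ S then (S.card : ℝ)⁻¹ else 0

/-- A finite set `σ` is dominant for a family of orders if no point lies strictly above
the minimum of `σ` in every order. -/
def Dominant {I V α : Type*} [LinearOrder α] (f : I → V → α) (σ : Finset V) : Prop :=
  ∀ x, ∃ i, ∀ y ∈ σ, f i x ≤ f i y

theorem Dominant.mono {I V α : Type*} [LinearOrder α] {f : I → V → α} {σ τ : Finset V}
    (h : Dominant f σ) (hτ : τ ⊆ σ) : Dominant f τ := fun x =>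
  (h x).imp fun _ hi y hy => hi y (hτ hy)

open Classical in
theorem Dominant.card_extensions_eq_two {I V α : Type*} [Fintype I] [Fintype V] [LinearOrder α]
    {f : I → V → α} (hf : ∀ i, Function.Injective (f i)) {τ : Finset V} (hτ : Dominant f τ)
    (hne : τ.Nonempty) (hcard : τ.card + 1 = Fintype.card I)
    (hM : ∀ j, ∃ x, ∀ i, i ≠ j → ∃ y ∈ τ, f i y < f i x) :
    (Finset.univ.filter fun y => y ∉ τ ∧ Dominant f (insert y τ)).card = 2 := by
  have hm : ∀ i, ∃ v ∈ τ, ∀ y ∈ τ, f i v ≤ f i y := fun i => Finset.exists_min_image τ (f i) hne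
  choose m hmτ hmle using hm
  have huniq : ∀ i t, t ∈ τ → (∀ y ∈ τ, f i t ≤ f i y) → m i = t := fun i t ht h =>
    hf i (le_antisymm (hmle i t ht) (h _ (hmτ i)))
  have hsurj : ∀ t ∈ τ, ∃ i, m i = t := fun t ht => by
    obtain ⟨i, hi⟩ := hτ t
    exact ⟨i, huniq i t ht hi⟩
  obtain ⟨a, -, b, -, hab, hmab⟩ : ∃ a ∈ (Finset.univ : Finset I), ∃ b ∈ (Finset.univ : Finset I),
      a ≠ b ∧ m a = m b := by
    refine Finset.exists_ne_map_eq_of_card_lt_of_maps_to (t := τ) ?_ (fun i _ => hmτ i)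
    rw [Finset.card_univ]; omega
  -- the minima indexed by the complement of two indices cannot exhaust `τ`
  have hpair : ∀ i j, i ≠ j → ¬ ∀ t ∈ τ, ∃ l, l ≠ i ∧ l ≠ j ∧ m l = t := by
    intro i j hij h
    have h1 : τ ⊆ ((Finset.univ.erase i).erase j).image m := by
      intro t ht
      obtain ⟨l, hli, hlj, hl⟩ := h t ht
      exact Finset.mem_image.2 ⟨l, by simp [hli, hlj], hl⟩
    have h2 := (Finset.card_le_card h1).trans Finset.card_image_le
    rw [Finset.card_erase_of_mem (by simp [hij.symm]), Finset.card_erase_of_mem (by simp),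
      Finset.card_univ] at h2
    have := hne.card_pos
    omega
  have hsurj' : ∀ j, j = a ∨ j = b → ∀ t ∈ τ, ∃ i, i ≠ j ∧ m i = t := by
    rintro j hj t ht
    obtain ⟨i, hi⟩ := hsurj t ht
    by_cases hij : i = j
    · rcases hj with rfl | rfl
      · exact ⟨b, hab.symm, by rw [← hmab, ← hij, hi]⟩
      · exact ⟨a, hab, by rw [hmab, ← hij, hi]⟩
    · exact ⟨i, hij, hi⟩
  have hmax : ∀ j, ∃ y, (∀ i, i ≠ j → f i (m i) < f i y) ∧
      ∀ x, (∀ i, i ≠ j → f i (m i) < f i x) → f j x ≤ f j y := by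
    intro j
    obtain ⟨y, hy, hmx⟩ := Finset.exists_max_image
      (Finset.univ.filter fun x => ∀ i, i ≠ j → f i (m i) < f i x) (f j) (by
        obtain ⟨x, hx⟩ := hM j
        refine ⟨x, Finset.mem_filter.2 ⟨Finset.mem_univ _, fun i hi => ?_⟩⟩
        obtain ⟨y, hy, hyx⟩ := hx i hi
        exact (hmle i y hy).trans_lt hyx)
    simp only [Finset.mem_filter, Finset.mem_univ, true_and] at hy hmx
    exact ⟨y, hy, hmx⟩
  choose Y hY hYmax using hmax
  have hle : ∀ j x, (∀ i, i ≠ j → f i (m i) < f i x) → ∀ y ∈ τ, f j x ≤ f j y := by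
    intro j x hx
    obtain ⟨i, hi⟩ := hτ x
    by_cases hij : i = j
    · exact hij ▸ hi
    · exact absurd (hi _ (hmτ i)) (not_le.2 (hx i hij))
  have hYab : Y a ≠ Y b := by
    intro h
    have h1 := hY b a hab
    rw [← h] at h1
    exact absurd (hle a (Y a) (hY a) (m a) (hmτ a)) (not_le.2 h1)
  have hroom : ∀ j, j = a ∨ j = b → Y j ∉ τ ∧ Dominant f (insert (Y j) τ) := by
    intro j hj
    refine ⟨fun hmem => ?_, fun x => ?_⟩
    · obtain ⟨i, hij, hi⟩ := hsurj' j hj _ hmem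
      exact absurd (hY j i hij) (by rw [hi]; exact lt_irrefl _)
    · by_cases hx : ∀ i, i ≠ j → f i (m i) < f i x
      · refine ⟨j, fun y hy => ?_⟩
        rcases Finset.mem_insert.1 hy with rfl | hy
        · exact hYmax j x hx
        · exact hle j x hx y hy
      · push Not at hx
        obtain ⟨i, hij, hi⟩ := hx
        refine ⟨i, fun y hy => ?_⟩
        rcases Finset.mem_insert.1 hy with rfl | hy
        · exact hi.trans (hY j i hij).le
        · exact hi.trans (hmle i y hy)
  have hset : (Finset.univ.filter fun y => y ∉ τ ∧ Dominant f (insert y τ)) = {Y a, Y b} := by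
    ext y
    simp only [Finset.mem_filter, Finset.mem_univ, true_and, Finset.mem_insert,
      Finset.mem_singleton]
    refine ⟨fun ⟨hyτ, hy⟩ => ?_, ?_⟩
    · obtain ⟨j, hj⟩ := hy y
      have hother : ∀ l, (∀ z ∈ insert y τ, f l y ≤ f l z) → ∀ t ∈ τ, ∀ i,
          (∀ z ∈ insert y τ, f i t ≤ f i z) → i ≠ l := by
        rintro l hl t ht i hi rfl
        have : t = y := hf i (le_antisymm (hi y (by simp)) (hl t (by simp [ht])))
        exact hyτ (this ▸ ht)
      have hjM : ∀ i, i ≠ j → f i (m i) < f i y := by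
        intro i hij
        by_contra hlt
        refine hpair i j hij fun t ht => ?_
        obtain ⟨l, hl⟩ := hy t
        refine ⟨l, hother i (fun z hz => ?_) t ht l hl, hother j hj t ht l hl,
          huniq l t ht fun z hz => hl z (by simp [hz])⟩
        rcases Finset.mem_insert.1 hz with rfl | hz
        · exact le_rfl
        · exact (not_lt.1 hlt).trans (hmle i z hz)
      have hjab : j = a ∨ j = b := by
        by_contra hjn
        push Not at hjn
        refine hpair a j hjn.1.symm fun t ht => ?_
        obtain ⟨l, hl⟩ := hy t
        have hlj := hother j hj t ht l hl
        have hlt : m l = t := huniq l t ht fun z hz => hl z (by simp [hz])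
        by_cases hla : l = a
        · exact ⟨b, hab.symm, hjn.2.symm, by rw [← hmab, ← hla, hlt]⟩
        · exact ⟨l, hla, hlj, hlt⟩
      have hyY : y = Y j := by
        refine hf j (le_antisymm (hYmax j y hjM) ?_)
        obtain ⟨i, hi⟩ := hy (Y j)
        by_cases hij : i = j
        · exact hij ▸ hi y (by simp)
        · exact absurd (hi (m i) (by simp [hmτ i])) (not_le.2 (hY j i hij))
      rcases hjab with rfl | rfl
      · exact Or.inl hyY
      · exact Or.inr hyY
    · rintro (rfl | rfl)
      · exact hroom a (Or.inl rfl)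
      · exact hroom b (Or.inr rfl)
  rw [hset, Finset.card_pair hYab]

open Classical in
theorem even_card_filter_image_erase_s5 {I V : Type*} [Fintype I] (c : V → I) (i₀ : I)
    {σ : Finset V} (hcard : σ.card = Fintype.card I) (hσ : σ.image c ≠ Finset.univ) :
    Even (σ.filter fun y => (σ.erase y).image c = Finset.univ.erase i₀).card := by
  rcases (σ.filter fun y => (σ.erase y).image c = Finset.univ.erase i₀).eq_empty_or_nonempty with
    h | ⟨y, hy⟩
  · simp [h]
  obtain ⟨hyσ, hy⟩ := Finset.mem_filter.1 hy
  have hinj : Set.InjOn c (σ.erase y : Finset V) := by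
    rw [← Finset.card_image_iff, hy, Finset.card_erase_of_mem (Finset.mem_univ _),
      Finset.card_erase_of_mem hyσ, hcard, Finset.card_univ]
  have hcy : c y ≠ i₀ := by
    intro h
    apply hσ
    rw [← Finset.insert_erase hyσ, Finset.image_insert, hy, h]
    exact Finset.insert_erase (Finset.mem_univ _)
  obtain ⟨y', hy', hcy'⟩ : ∃ y' ∈ σ.erase y, c y' = c y := by
    rw [← Finset.mem_image, hy]
    simpa using hcy
  have hne : y' ≠ y := Finset.ne_of_mem_erase hy'
  have hy'σ : y' ∈ σ := Finset.mem_of_mem_erase hy'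
  have hset : (σ.filter fun y => (σ.erase y).image c = Finset.univ.erase i₀) = {y, y'} := by
    ext z
    simp only [Finset.mem_filter, Finset.mem_insert, Finset.mem_singleton]
    constructor
    · rintro ⟨hzσ, hz⟩
      by_contra hzn
      push Not at hzn
      have h1 : Set.InjOn c (σ.erase z : Finset V) := by
        rw [← Finset.card_image_iff, hz, Finset.card_erase_of_mem (Finset.mem_univ _),
          Finset.card_erase_of_mem hzσ, hcard, Finset.card_univ]
      exact hne (h1 (by simp [hzn.2.symm, hy'σ]) (by simp [hzn.1.symm, hyσ]) hcy')
    · rintro (rfl | rfl)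
      · exact ⟨hyσ, hy⟩
      · refine ⟨hy'σ, ?_⟩
        rw [← hy]
        ext i
        simp only [Finset.mem_image, Finset.mem_erase]
        constructor
        · rintro ⟨w, ⟨hw, hwσ⟩, rfl⟩
          by_cases hwy : w = y
          · exact ⟨z, ⟨hne, hy'σ⟩, by rw [hwy, hcy']⟩
          · exact ⟨w, ⟨hwy, hwσ⟩, rfl⟩
        · rintro ⟨w, ⟨hw, hwσ⟩, rfl⟩
          by_cases hwy : w = z
          · exact ⟨y, ⟨hne.symm, hyσ⟩, by rw [hwy, hcy']⟩
          · exact ⟨w, ⟨hwy, hwσ⟩, rfl⟩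
  rw [hset, Finset.card_pair hne.symm]
  exact even_two

open Classical in
/-- Scarf's lemma: a coloring of a finite set with a family of orders, extended by slack
elements `e i`, admits a dominant set on which every color appears exactly once. -/
theorem exists_dominant_image_eq_univ_s5 {I V α : Type*} [Fintype I] [Nonempty I] [Fintype V]
    [LinearOrder α] {f : I → V → α} (hf : ∀ i, Function.Injective (f i)) {e : I → V}
    (hmin : ∀ i v, f i (e i) ≤ f i v)
    (hmax : ∀ i j v, j ≠ i → v ∉ Set.range e → f i v < f i (e j))
    (hV : ∃ v, v ∉ Set.range e) {c : V → I} (hc : ∀ i, c (e i) = i) :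
    ∃ σ : Finset V, Dominant f σ ∧ σ.card = Fintype.card I ∧ σ.image c = Finset.univ := by
  by_contra hcon
  push Not at hcon
  obtain ⟨i₀⟩ := ‹Nonempty I›
  let R : Finset (Finset V) := Finset.univ.filter fun σ => Dominant f σ ∧ σ.card = Fintype.card I
  let D : Finset (Finset V) := Finset.univ.filter fun τ =>
    τ.image c = Finset.univ.erase i₀ ∧ τ.card + 1 = Fintype.card I
  have hcount := Finset.sum_card_bipartiteAbove_eq_sum_card_bipartiteBelow
    (s := R) (t := D) (fun σ τ => τ ⊆ σ)
  have hR : Even (∑ σ ∈ R, (D.bipartiteAbove (fun σ τ => τ ⊆ σ) σ).card) := by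
    refine Finset.even_sum _ fun σ hσ => ?_
    obtain ⟨hdom, hcard⟩ := (Finset.mem_filter.1 hσ).2
    have : D.bipartiteAbove (fun σ τ => τ ⊆ σ) σ =
        (σ.filter fun y => (σ.erase y).image c = Finset.univ.erase i₀).image σ.erase := by
      ext τ
      simp only [Finset.mem_bipartiteAbove, D, Finset.mem_filter, Finset.mem_univ, true_and,
        Finset.mem_image]
      constructor
      · rintro ⟨⟨h1, h2⟩, h3⟩
        obtain ⟨y, hy, rfl⟩ := Finset.exists_eq_insert_iff.2 ⟨h3, h2.trans hcard.symm⟩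
        exact ⟨y, ⟨by simp, by rwa [Finset.erase_insert hy]⟩, Finset.erase_insert hy⟩
      · rintro ⟨y, ⟨h1, h2⟩, rfl⟩
        exact ⟨⟨h2, by rw [Finset.card_erase_add_one h1, hcard]⟩, Finset.erase_subset _ _⟩
    rw [this, Finset.card_image_of_injOn
      ((Finset.erase_injOn σ).mono fun y hy => (Finset.mem_filter.1 hy).1)]
    exact even_card_filter_image_erase_s5 c i₀ hcard (hcon σ hdom hcard)
  have hbelow : ∀ τ ∈ D, (R.bipartiteBelow (fun σ τ => τ ⊆ σ) τ).card =
      (Finset.univ.filter fun y => y ∉ τ ∧ Dominant f (insert y τ)).card := by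
    intro τ hτ
    obtain ⟨-, hcard⟩ := (Finset.mem_filter.1 hτ).2
    have : R.bipartiteBelow (fun σ τ => τ ⊆ σ) τ =
        (Finset.univ.filter fun y => y ∉ τ ∧ Dominant f (insert y τ)).image
          fun y => insert y τ := by
      ext σ
      simp only [Finset.mem_bipartiteBelow, R, Finset.mem_filter, Finset.mem_univ, true_and,
        Finset.mem_image]
      constructor
      · rintro ⟨⟨h1, h2⟩, h3⟩
        obtain ⟨y, hy, rfl⟩ := Finset.exists_eq_insert_iff.2 ⟨h3, hcard.trans h2.symm⟩
        exact ⟨y, ⟨hy, h1⟩, rfl⟩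
      · rintro ⟨y, ⟨h1, h2⟩, rfl⟩
        exact ⟨⟨h2, by rw [Finset.card_insert_of_notMem h1, hcard]⟩, Finset.subset_insert _ _⟩
    rw [this, Finset.card_image_of_injOn]
    intro y hy z hz hyz
    have hyz : insert y τ = insert z τ := hyz
    have : y ∈ insert z τ := hyz ▸ Finset.mem_insert_self y τ
    exact (Finset.mem_insert.1 this).resolve_right (Finset.mem_filter.1 hy).2.1
  have he : Function.Injective e := fun i j h => by rw [← hc i, h, hc]
  let τ₀ : Finset V := (Finset.univ.erase i₀).image e
  have hτ₀c : τ₀.image c = Finset.univ.erase i₀ := by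
    rw [Finset.image_image, show c ∘ e = id from funext hc, Finset.image_id]
  have hτ₀ : τ₀ ∈ D := by
    refine Finset.mem_filter.2 ⟨Finset.mem_univ _, hτ₀c, ?_⟩
    rw [Finset.card_image_of_injective _ he, Finset.card_erase_add_one (Finset.mem_univ _),
      Finset.card_univ]
  have hmemτ₀ : ∀ j, j ≠ i₀ → e j ∈ τ₀ := fun j hj => Finset.mem_image.2 ⟨j, by simp [hj], rfl⟩
  have hodd : (Finset.univ.filter fun y => y ∉ τ₀ ∧ Dominant f (insert y τ₀)).card = 1 := by
    obtain ⟨v, hv, hvmax⟩ := Finset.exists_max_image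
      (Finset.univ.filter fun v => v ∉ Set.range e) (f i₀) (by simpa [Finset.Nonempty] using hV)
    simp only [Finset.mem_filter, Finset.mem_univ, true_and] at hv hvmax
    rw [Finset.card_eq_one]
    refine ⟨v, ?_⟩
    ext y
    simp only [Finset.mem_filter, Finset.mem_univ, true_and, Finset.mem_singleton]
    constructor
    · rintro ⟨hy, hdom⟩
      obtain ⟨i, hi⟩ := hdom v
      have hii : i = i₀ := by
        by_contra hii
        have h1 := hi (e i) (by simp [hmemτ₀ i hii])
        exact hv ⟨i, (hf i (le_antisymm h1 (hmin i v))).symm⟩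
      subst hii
      have hle := hi y (by simp)
      have hyr : y ∉ Set.range e := by
        rintro ⟨j, rfl⟩
        by_cases hj : j = i
        · subst hj
          exact hv ⟨j, (hf j (le_antisymm hle (hmin j v))).symm⟩
        · exact hy (hmemτ₀ j hj)
      exact hf i (le_antisymm (hvmax y hyr) hle)
    · rintro rfl
      have hyτ : y ∉ τ₀ := fun h => by
        obtain ⟨j, -, hj⟩ := Finset.mem_image.1 h
        exact hv ⟨j, hj⟩
      refine ⟨hyτ, fun x => ?_⟩
      by_cases hx : x ∈ Set.range e
      · obtain ⟨j, rfl⟩ := hx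
        exact ⟨j, fun z _ => hmin j z⟩
      · refine ⟨i₀, fun z hz => ?_⟩
        rcases Finset.mem_insert.1 hz with rfl | hz
        · exact hvmax x hx
        · obtain ⟨j, hj, rfl⟩ := Finset.mem_image.1 hz
          exact (hmax i₀ j x (Finset.ne_of_mem_erase hj) hx).le
  have heven : ∀ τ ∈ D.erase τ₀, Even (R.bipartiteBelow (fun σ τ => τ ⊆ σ) τ).card := by
    intro τ hτ
    obtain ⟨hne, hτD⟩ := Finset.mem_erase.1 hτ
    rw [hbelow τ hτD]
    obtain ⟨hτc, hcard⟩ := (Finset.mem_filter.1 hτD).2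
    by_cases hdom : Dominant f τ
    · obtain ⟨y, hyτ, hy⟩ : ∃ y ∈ τ, y ∉ Set.range e := by
        by_contra h
        push Not at h
        refine hne (Finset.eq_of_subset_of_card_le (fun y hy => ?_) ?_)
        · obtain ⟨j, rfl⟩ := h y hy
          refine hmemτ₀ j fun hj => ?_
          have := Finset.mem_image_of_mem c hy
          simp [hτc, hc, hj] at this
        · have := (Finset.mem_filter.1 hτ₀).2.2
          omega
      rw [hdom.card_extensions_eq_two hf ⟨y, hyτ⟩ hcard
        fun j => ⟨e j, fun i hi => ⟨y, hyτ, hmax i j y hi.symm hy⟩⟩]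
      exact even_two
    · rw [Finset.filter_false_of_mem]
      · simp
      · exact fun y _ h => hdom (h.2.mono (Finset.subset_insert _ _))
  rw [hcount, ← Finset.add_sum_erase _ _ hτ₀, hbelow τ₀ hτ₀, hodd] at hR
  have := Finset.even_sum _ heven
  rw [Nat.even_iff] at hR this
  omega

/-- The orders on a finite set of points, extended by slack elements, used in Scarf's lemma:
compare coordinates and break ties by an index. -/
noncomputable def slackOrder {I : Type*} [Fintype I] {t : Set (I → ℝ)} [Fintype t] [DecidableEq I]
    (i : I) : t ⊕ I → ℕ ×ₗ ℝ ×ₗ ℕ :=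
  Sum.elim (fun x => toLex (1, toLex (x.1 i, (Fintype.equivFin t x : ℕ))))
    fun j => toLex (if j = i then 0 else 2, toLex (0, (Fintype.equivFin I j : ℕ)))

theorem slackOrder_injective {I : Type*} [Fintype I] {t : Set (I → ℝ)} [Fintype t]
    [DecidableEq I] (i : I) : Function.Injective (slackOrder (t := t) i) := by
  rintro (x | j) (y | l) h
  · simp only [slackOrder, Sum.elim_inl, EmbeddingLike.apply_eq_iff_eq, Prod.mk.injEq,
      true_and, Fin.val_inj] at h
    rw [h.2]
  · simp only [slackOrder, Sum.elim_inl, Sum.elim_inr, EmbeddingLike.apply_eq_iff_eq,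
      Prod.mk.injEq] at h
    have h := h.1
    split_ifs at h
    omega
  · simp only [slackOrder, Sum.elim_inl, Sum.elim_inr, EmbeddingLike.apply_eq_iff_eq,
      Prod.mk.injEq] at h
    have h := h.1
    split_ifs at h
    omega
  · simp only [slackOrder, Sum.elim_inr, EmbeddingLike.apply_eq_iff_eq, Prod.mk.injEq,
      true_and, Fin.val_inj] at h
    rw [h.2]

theorem slackOrder_inr_self_lt {I : Type*} [Fintype I] {t : Set (I → ℝ)} [Fintype t]
    [DecidableEq I] (i : I) (x : t) : slackOrder (t := t) i (Sum.inr i) < slackOrder i (Sum.inl x) := by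
  simp [slackOrder, Prod.Lex.toLex_lt_toLex]

theorem slackOrder_inl_lt_inr {I : Type*} [Fintype I] {t : Set (I → ℝ)} [Fintype t]
    [DecidableEq I] {i j : I} (hij : j ≠ i) (x : t) :
    slackOrder i (Sum.inl x) < slackOrder (t := t) i (Sum.inr j) := by
  simp [slackOrder, Prod.Lex.toLex_lt_toLex, hij]

theorem slackOrder_inr_self_le {I : Type*} [Fintype I] {t : Set (I → ℝ)} [Fintype t]
    [DecidableEq I] (i : I) (v : t ⊕ I) : slackOrder (t := t) i (Sum.inr i) ≤ slackOrder i v := by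
  rcases v with x | j
  · exact (slackOrder_inr_self_lt i x).le
  · by_cases hj : j = i
    · rw [hj]
    · refine le_of_lt ?_
      simp [slackOrder, Prod.Lex.toLex_lt_toLex, hj]

theorem apply_le_of_slackOrder_le {I : Type*} [Fintype I] {t : Set (I → ℝ)} [Fintype t]
    [DecidableEq I] {i : I} {x y : t}
    (h : slackOrder i (Sum.inl x) ≤ slackOrder i (Sum.inl y)) : x.1 i ≤ y.1 i := by
  simp only [slackOrder, Sum.elim_inl, Prod.Lex.toLex_le_toLex, lt_irrefl, true_and,
    false_or] at h
  rcases h with h | h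
  · exact h.le
  · exact h.1.le

open Classical in
theorem exists_approx_mem_of_cover_stdSimplex {I : Type*} [Fintype I] [Nonempty I]
    {B : I → Set (I → ℝ)} (hB : ∀ x ∈ stdSimplex ℝ I, ∃ i, x ∈ B i) {δ : ℝ} (hδ : 0 < δ) :
    ∃ w ∈ stdSimplex ℝ I, ∀ i, w i ≤ δ ∨ ∃ y ∈ B i, dist w y ≤ δ := by
  have hn : (0 : ℝ) < Fintype.card I := by exact_mod_cast Fintype.card_pos
  obtain ⟨t, htΔ, htfin, htcover⟩ :=
    (isCompact_stdSimplex ℝ I).finite_cover_balls (div_pos hδ hn)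
  have hnet : ∀ x ∈ stdSimplex ℝ I, ∃ y : t, dist x y.1 < δ / Fintype.card I := by
    intro x hx
    obtain ⟨y, hy, hxy⟩ := Set.mem_iUnion₂.1 (htcover hx)
    exact ⟨⟨y, hy⟩, hxy⟩
  have := htfin.fintype
  obtain ⟨v⟩ : Nonempty t := by
    obtain ⟨i⟩ := ‹Nonempty I›
    obtain ⟨y, -⟩ := hnet _ (single_mem_stdSimplex ℝ i)
    exact ⟨y⟩
  choose c hc using fun x : t => hB x.1 (htΔ x.2)
  obtain ⟨σ, hdom, -, himg⟩ := exists_dominant_image_eq_univ_s5 (f := slackOrder (t := t))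
    slackOrder_injective (e := Sum.inr) slackOrder_inr_self_le
    (fun i j v hij hv => by
      rcases v with x | l
      · exact slackOrder_inl_lt_inr hij x
      · exact absurd ⟨l, rfl⟩ hv)
    ⟨Sum.inl v, by simp⟩ (c := Sum.elim c id) fun i => rfl
  have hcolor : ∀ i, Sum.inr i ∉ σ → ∃ x : t, Sum.inl x ∈ σ ∧ c x = i := by
    intro i hi
    obtain ⟨y, hy, hyi⟩ := Finset.mem_image.1 (himg ▸ Finset.mem_univ i)
    rcases y with x | j
    · exact ⟨x, hy, hyi⟩
    · exact absurd (show j = i from hyi) fun h => hi (h ▸ hy)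
  have hdomt : ∀ x : t, ∃ i, Sum.inr i ∉ σ ∧ ∀ y : t, Sum.inl y ∈ σ → x.1 i ≤ y.1 i := by
    intro x
    obtain ⟨i, hi⟩ := hdom (Sum.inl x)
    exact ⟨i, fun h => absurd (hi _ h) (not_le.2 (slackOrder_inr_self_lt i x)),
      fun y hy => apply_le_of_slackOrder_le (hi _ hy)⟩
  obtain ⟨i₁, hi₁, -⟩ := hdomt v
  obtain ⟨w, hw, -⟩ := hcolor i₁ hi₁
  have hmin : ∀ i, ∃ u : t, Sum.inl u ∈ σ ∧ ∀ y : t, Sum.inl y ∈ σ → u.1 i ≤ y.1 i := by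
    intro i
    obtain ⟨u, hu, hmin⟩ := Finset.exists_min_image
      (Finset.univ.filter fun x : t => Sum.inl x ∈ σ) (fun x => x.1 i) ⟨w, by simpa using hw⟩
    simp only [Finset.mem_filter, Finset.mem_univ, true_and] at hu hmin
    exact ⟨u, hu, hmin⟩
  choose u huσ humin using hmin
  let C : Finset I := Finset.univ.filter fun i => Sum.inr i ∉ σ
  have hmemC : ∀ i, i ∈ C ↔ Sum.inr i ∉ σ := fun i => by simp [C]
  have hCpos : (0 : ℝ) < C.card := by exact_mod_cast Finset.card_pos.2 ⟨i₁, (hmemC _).2 hi₁⟩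
  let m : I → ℝ := fun i => if i ∈ C then (u i).1 i else 0
  have hm0 : ∀ i, 0 ≤ m i := fun i => by
    by_cases hi : i ∈ C
    · simpa [m, hi] using (htΔ (u i).2).1 i
    · simp [m, hi]
  have hmle : ∀ y : t, Sum.inl y ∈ σ → ∀ i, m i ≤ y.1 i := fun y hy i => by
    by_cases hi : i ∈ C
    · simpa [m, hi] using humin i y hy
    · simpa [m, hi] using (htΔ y.2).1 i
  have hsum : 1 - δ ≤ ∑ i, m i := by
    by_contra hlt
    push Not at hlt
    have hgap : δ / Fintype.card I < (1 - ∑ i, m i) / C.card := by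
      have hle : (C.card : ℝ) ≤ Fintype.card I := by exact_mod_cast Finset.card_le_univ C
      calc δ / Fintype.card I ≤ δ / C.card := div_le_div_of_nonneg_left hδ.le hCpos hle
        _ < _ := div_lt_div_of_pos_right (by linarith) hCpos
    have hx : (fun i => m i + if i ∈ C then (1 - ∑ i, m i) / C.card else 0) ∈
        stdSimplex ℝ I := by
      refine ⟨fun i => add_nonneg (hm0 i) ?_, ?_⟩
      · split_ifs
        · exact ((div_pos hδ hn).trans hgap).le
        · exact le_rfl
      · have hconst : ∀ r : ℝ, ∑ i, (if i ∈ C then r / C.card else 0) = r := fun r => by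
          rw [Finset.sum_ite_mem, Finset.univ_inter, Finset.sum_const, nsmul_eq_mul,
            mul_div_cancel₀ _ hCpos.ne']
        rw [Finset.sum_add_distrib, hconst, add_sub_cancel]
    obtain ⟨x, hxd⟩ := hnet _ hx
    obtain ⟨i, hi, hxi⟩ := hdomt x
    have hi := (hmemC i).2 hi
    have h1 := (dist_le_pi_dist _ x.1 i).trans_lt hxd
    have h2 := hxi _ (huσ i)
    simp only [Real.dist_eq, hi, if_true, m] at h1
    have h3 := (abs_lt.1 h1).2
    simp only [m] at hgap
    linarith
  have hclose : ∀ y : t, Sum.inl y ∈ σ → ∀ i, y.1 i ≤ m i + δ := by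
    intro y hy i
    have h1 : y.1 i - m i ≤ ∑ j, (y.1 j - m j) :=
      Finset.single_le_sum (f := fun j => y.1 j - m j)
        (fun j _ => sub_nonneg.2 (hmle y hy j)) (Finset.mem_univ i)
    rw [Finset.sum_sub_distrib, (htΔ y.2).2] at h1
    linarith
  refine ⟨w, htΔ w.2, fun i => ?_⟩
  by_cases hi : i ∈ C
  · obtain ⟨x, hxσ, rfl⟩ := hcolor i ((hmemC i).1 hi)
    refine Or.inr ⟨x, hc x, (dist_pi_le_iff hδ.le).2 fun l => ?_⟩
    rw [Real.dist_eq, abs_le]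
    constructor <;> linarith [hclose x hxσ l, hclose w hw l, hmle x hxσ l, hmle w hw l]
  · left
    simpa [m, hi] using hclose w hw i

/-- If closed sets `B i` cover the standard simplex, then some point of the simplex lies in `B i`
for every `i` in its support. -/
theorem exists_mem_of_isClosed_cover_stdSimplex {I : Type*} [Fintype I] [Nonempty I]
    {B : I → Set (I → ℝ)} (hclosed : ∀ i, IsClosed (B i))
    (hB : ∀ x ∈ stdSimplex ℝ I, ∃ i, x ∈ B i) :
    ∃ z ∈ stdSimplex ℝ I, ∀ i, 0 < z i → z ∈ B i := by
  choose w hwΔ hw using fun n : ℕ =>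
    exists_approx_mem_of_cover_stdSimplex hB (δ := 1 / ((n : ℝ) + 1)) (by positivity)
  obtain ⟨z, hz, φ, hφ, hlim⟩ := (isCompact_stdSimplex ℝ I).tendsto_subseq hwΔ
  refine ⟨z, hz, fun i hi => ?_⟩
  rw [← (hclosed i).closure_eq, Metric.mem_closure_iff]
  intro ε hε
  have hδ : Filter.Tendsto (fun n => 1 / ((φ n : ℝ) + 1)) Filter.atTop (nhds 0) :=
    tendsto_one_div_add_atTop_nhds_zero_nat.comp hφ.tendsto_atTop
  have hcoord : Filter.Tendsto (fun n => w (φ n) i) Filter.atTop (nhds (z i)) :=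
    (tendsto_pi_nhds.1 hlim) i
  have h1 := hδ.eventually (gt_mem_nhds (half_pos hi))
  have h2 := hδ.eventually (gt_mem_nhds (half_pos hε))
  have h3 := hcoord.eventually (lt_mem_nhds (half_lt_self hi))
  have h4 := hlim.eventually (Metric.ball_mem_nhds z (half_pos hε))
  obtain ⟨n, h1, h2, h3, h4⟩ := (h1.and (h2.and (h3.and h4))).exists
  rcases hw (φ n) i with h | ⟨y, hy, hwy⟩
  · linarith
  · refine ⟨y, hy, ?_⟩
    have h4 : dist (w (φ n)) z < ε / 2 := h4
    rw [dist_comm] at h4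
    linarith [dist_triangle z (w (φ n)) y]

theorem faceBarycenter_eq_sum (k : ℕ) (S : Finset (Fin (k + 1))) :
    faceBarycenter k S = ∑ i ∈ S, (S.card : ℝ)⁻¹ • Pi.single i (1 : ℝ) := by
  ext j
  simp [faceBarycenter, Finset.sum_apply, Pi.single_apply]

theorem map_faceBarycenter (k : ℕ) (S : Finset (Fin (k + 1)))
    (φ : StrongDual ℝ (Fin (k + 1) → ℝ)) :
    φ (faceBarycenter k S) = (S.card : ℝ)⁻¹ * ∑ i ∈ S, φ (Pi.single i 1) := by
  simp [faceBarycenter_eq_sum, map_sum, Finset.mul_sum]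

theorem map_faceBarycenter_le {k : ℕ} {S : Finset (Fin (k + 1))} (hS : S.Nonempty)
    {φ : StrongDual ℝ (Fin (k + 1) → ℝ)} {r : ℝ} (h : ∀ i ∈ S, φ (Pi.single i 1) ≤ r) :
    φ (faceBarycenter k S) ≤ r := by
  have hpos : (0 : ℝ) < S.card := by exact_mod_cast hS.card_pos
  rw [map_faceBarycenter, inv_mul_le_iff₀ hpos]
  simpa using Finset.sum_le_card_nsmul S _ r h

theorem exists_map_single_le_map_faceBarycenter {k : ℕ} {S : Finset (Fin (k + 1))}
    (hS : S.Nonempty) (φ : StrongDual ℝ (Fin (k + 1) → ℝ)) :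
    ∃ i ∈ S, φ (Pi.single i 1) ≤ φ (faceBarycenter k S) := by
  refine Finset.exists_le_of_sum_le hS (le_of_eq ?_)
  have hpos : (0 : ℝ) < S.card := by exact_mod_cast hS.card_pos
  rw [Finset.sum_const, map_faceBarycenter, nsmul_eq_mul, mul_inv_cancel_left₀ hpos.ne']

theorem exists_mem_convexHull_faceBarycenter (k : ℕ)
    (A : Finset (Fin (k + 1)) → Set (Fin (k + 1) → ℝ))
    (hclosed : ∀ T : Finset (Fin (k + 1)), T.Nonempty → IsClosed (A T))
    (hcover : ∀ S : Finset (Fin (k + 1)), S.Nonempty →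
      simplexFace k S ⊆ ⋃ T ∈ {T : Finset (Fin (k + 1)) | T.Nonempty ∧ T ⊆ S}, A T) :
    ∃ x : Fin (k + 1) → ℝ, faceBarycenter k Finset.univ ∈
      convexHull ℝ (faceBarycenter k '' {T | T.Nonempty ∧ x ∈ A T}) := by
  by_contra hcon
  push Not at hcon
  obtain ⟨g, hg⟩ : ∃ g : C(stdSimplex ℝ (Fin (k + 1)), StrongDual ℝ (Fin (k + 1) → ℝ)),
      ∀ x, g x ∈ {φ : StrongDual ℝ (Fin (k + 1) → ℝ) | ∀ T : Finset (Fin (k + 1)), T.Nonempty →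
        x.1 ∈ A T → φ (faceBarycenter k Finset.univ) < φ (faceBarycenter k T)} := by
    refine exists_continuous_forall_mem_convex_of_local_const (fun x => ?_) fun x => ?_
    · intro φ hφ ψ hψ a b ha hb hab T hT hx
      have h1 := hφ T hT hx
      have h2 := hψ T hT hx
      simp only [add_apply, smul_apply, smul_eq_mul]
      rcases ha.eq_or_lt with rfl | ha
      · rw [zero_add] at hab
        simpa [hab] using h2
      · nlinarith [mul_lt_mul_of_pos_left h1 ha, mul_le_mul_of_nonneg_left h2.le hb]
    · obtain ⟨φ, r, hr, hφ⟩ := geometric_hahn_banach_point_closed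
        (convex_convexHull ℝ (faceBarycenter k '' {T | T.Nonempty ∧ x.1 ∈ A T}))
        ((Set.toFinite _).isClosed_convexHull ℝ) (hcon x.1)
      refine ⟨φ, ?_⟩
      have hev : ∀ T : Finset (Fin (k + 1)), ∀ᶠ y : stdSimplex ℝ (Fin (k + 1)) in nhds x,
          T.Nonempty → y.1 ∈ A T → x.1 ∈ A T := by
        intro T
        by_cases hT : T.Nonempty ∧ x.1 ∉ A T
        · have := ((hclosed T hT.1).preimage continuous_subtype_val).isOpen_compl.mem_nhds
            (x := x) hT.2
          filter_upwards [this] with y hy _ hyA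
          exact absurd hyA hy
        · push Not at hT
          exact Filter.Eventually.of_forall fun y hne _ => hT hne
      filter_upwards [Filter.eventually_all.2 hev] with y hy T hT hyT
      exact hr.trans (hφ _ (subset_convexHull ℝ _ ⟨T, ⟨hT, hy T hT hyT⟩, rfl⟩))
  let B : Fin (k + 1) → Set (Fin (k + 1) → ℝ) := fun i => Subtype.val ''
    {x : stdSimplex ℝ (Fin (k + 1)) | g x (Pi.single i 1) ≤ g x (faceBarycenter k Finset.univ)}
  obtain ⟨z, hz, hzB⟩ := exists_mem_of_isClosed_cover_stdSimplex (B := B)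
    (fun i => (isClosed_stdSimplex ℝ (Fin (k + 1))).isClosedEmbedding_subtypeVal.isClosedMap _
      (isClosed_le (by fun_prop) (by fun_prop)))
    (fun x hx => by
      obtain ⟨i, -, hi⟩ := exists_map_single_le_map_faceBarycenter Finset.univ_nonempty (g ⟨x, hx⟩)
      exact ⟨i, ⟨x, hx⟩, hi, rfl⟩)
  let S : Finset (Fin (k + 1)) := Finset.univ.filter fun i => 0 < z i
  have hS : S.Nonempty := by
    obtain ⟨i, -, hi⟩ := Finset.exists_lt_of_sum_lt (s := Finset.univ) (f := fun _ => (0 : ℝ))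
      (g := z) (by rw [hz.2]; simp)
    exact ⟨i, by simpa [S] using hi⟩
  have hzS : z ∈ simplexFace k S :=
    ⟨hz, fun i hi => le_antisymm (by simpa [S] using hi) (hz.1 i)⟩
  obtain ⟨T, ⟨hT, hTS⟩, hzT⟩ := Set.mem_iUnion₂.1 (hcover S hS hzS)
  refine absurd (hg ⟨z, hz⟩ T hT hzT) (not_lt.2 (map_faceBarycenter_le hT fun i hi => ?_))
  obtain ⟨⟨y, hy⟩, hyB, rfl⟩ := hzB i (by simpa [S] using hTS hi)
  exact hyB


/-- **Shapley's KKMS theorem.** Let `{A T : T nonempty subset of [k+1]}` be closed subsets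
of the standard `k`-simplex with `Δ^S ⊆ ⋃ {A T : ∅ ≠ T ⊆ S}` for every nonempty `S`
(a KKMS cover). Then there is a balanced collection `T 1, …, T m` of nonempty subsets of
`[k+1]` — i.e. the barycenter of `Δ_k` lies in the convex hull of the barycenters of
the faces `Δ^{T i}` — with `⋂ i, A (T i) ≠ ∅`. -/
theorem KKMS (k : ℕ) (A : Finset (Fin (k + 1)) → Set (Fin (k + 1) → ℝ))
    (hclosed : ∀ T : Finset (Fin (k + 1)), T.Nonempty → IsClosed (A T))
    (hsub : ∀ T : Finset (Fin (k + 1)), T.Nonempty → A T ⊆ stdSimplex ℝ (Fin (k + 1)))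
    (hcover : ∀ S : Finset (Fin (k + 1)), S.Nonempty →
      simplexFace k S ⊆ ⋃ T ∈ {T : Finset (Fin (k + 1)) | T.Nonempty ∧ T ⊆ S}, A T) :
    ∃ (m : ℕ) (Ts : Fin m → Finset (Fin (k + 1))),
      (∀ i, (Ts i).Nonempty) ∧
      (fun _ => ((k : ℝ) + 1)⁻¹) ∈ convexHull ℝ (Set.range fun i => faceBarycenter k (Ts i)) ∧
      (⋂ i, A (Ts i)).Nonempty := by
  obtain ⟨x, hx⟩ := exists_mem_convexHull_faceBarycenter k A hclosed hcover
  have hfin : {T : Finset (Fin (k + 1)) | T.Nonempty ∧ x ∈ A T}.Finite := Set.toFinite _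
  obtain ⟨m, Ts, -, hTs⟩ := hfin.fin_param
  have hmem : ∀ i, (Ts i).Nonempty ∧ x ∈ A (Ts i) := fun i => by
    have : Ts i ∈ Set.range Ts := ⟨i, rfl⟩
    rwa [hTs] at this
  refine ⟨m, Ts, fun i => (hmem i).1, ?_, x, Set.mem_iInter.2 fun i => (hmem i).2⟩
  rw [← hTs, ← Set.range_comp] at hx
  have hb : faceBarycenter k Finset.univ = fun _ => ((k : ℝ) + 1)⁻¹ := by
    ext i
    simp [faceBarycenter]
  rwa [hb] at hx
end

section
/- For each i ∈ [k+1], let A_1^(i), …, A_{k+1}^(i) be closed subsets of the standard k-simplex Δ_k such that Δ^S ⊆ ⋃_{j ∈ S} A_j^(i) for every nonempty S ⊆ [k+1] (i.e., each of the k+1 families is a KKM cover). Then there is a permutation π of [k+1] such that ⋂_{i ∈ [k+1]} A_{π(i)}^(i) ≠ ∅. -/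
namespace ColorfulKKM

/-- A self-map of a finite type is surjective iff an odd number of its restrictions to complements
of points still reach every value other than `c`. -/
lemma surjective_parity {ι : Type*} [Fintype ι] [DecidableEq ι] (f : ι → ι) (c : ι) :
    (if Function.Surjective f then 1 else 0 : ZMod 2) =
      ∑ t, if ∀ j, j ≠ c → ∃ s, s ≠ t ∧ f s = j then 1 else 0 := by
  classical
  by_cases hf : Function.Surjective f
  · have hinj := Finite.injective_iff_surjective.mpr hf
    obtain ⟨t₀, ht₀⟩ := hf c
    rw [if_pos hf, Finset.sum_eq_single t₀]
    · rw [if_pos]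
      intro j hj
      obtain ⟨s, rfl⟩ := hf j
      exact ⟨s, fun h => hj (h ▸ ht₀), rfl⟩
    · intro t _ ht
      rw [if_neg]
      intro h
      obtain ⟨s, hs, hst⟩ := h (f t) (fun h => ht (hinj (h.trans ht₀.symm)))
      exact hs (hinj hst)
    · simp
  · rw [if_neg hf]
    by_cases hex : ∃ t, ∀ j, j ≠ c → ∃ s, s ≠ t ∧ f s = j
    · obtain ⟨t₁, h₁⟩ := hex
      have hc : f t₁ ≠ c := by
        intro h
        refine hf fun j => ?_
        by_cases hj : j = c
        · exact ⟨t₁, h.trans hj.symm⟩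
        · obtain ⟨s, -, hs⟩ := h₁ j hj
          exact ⟨s, hs⟩
      obtain ⟨t₂, hne, h₂⟩ := h₁ _ hc
      have key : ∀ t, (∀ j, j ≠ c → ∃ s, s ≠ t ∧ f s = j) ↔ t ∈ ({t₁, t₂} : Finset ι) := by
        intro t
        simp only [Finset.mem_insert, Finset.mem_singleton]
        constructor
        · intro h
          by_contra! hcon
          have hsub : ({c}ᶜ : Finset ι) ⊆ ({t₁, t}ᶜ : Finset ι).image f := by
            intro j hj
            obtain ⟨s, hs, hsj⟩ := h j (by simpa using hj)
            rw [Finset.mem_image]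
            by_cases hst : s = t₁
            · exact ⟨t₂, by simp [hne, hcon.2.symm], by rw [h₂, ← hst, hsj]⟩
            · exact ⟨s, by simp [hst, hs], hsj⟩
          have h1 := (Finset.card_le_card hsub).trans Finset.card_image_le
          rw [Finset.card_compl, Finset.card_compl, Finset.card_pair hcon.1.symm,
            Finset.card_singleton] at h1
          have h2 := Finset.card_le_univ ({t₁, t} : Finset ι)
          rw [Finset.card_pair hcon.1.symm] at h2
          omega
        · rintro (rfl | rfl)
          · exact h₁
          · intro j hj
            obtain ⟨s, hs, hsj⟩ := h₁ j hj
            by_cases hst : s = t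
            · exact ⟨t₁, hne.symm, by rw [← h₂, ← hst, hsj]⟩
            · exact ⟨s, hst, hsj⟩
      simp only [key]
      rw [Finset.sum_ite_mem, Finset.univ_inter, Finset.sum_pair hne.symm]
      decide
    · push Not at hex
      rw [Finset.sum_eq_zero]
      intro t _
      rw [if_neg]
      push Not
      exact hex t

variable {k : ℕ}

/-- A maximal simplex (alcove) of the Freudenthal triangulation, presented as a periodic monotone
chain of lattice points; its vertices are `y 0, …, y k`. -/
structure IsAlcove (y : ℤ → Fin (k + 1) → ℤ) : Prop where
  mono : Monotone y
  periodic : ∀ s, y (s + (k + 1)) = y s + 1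
  sum_eq : ∀ s, ∑ a, y s a = s

/-- The barycentric coordinates, scaled by `N`, of a lattice point. -/
def coord (N : ℤ) (y : Fin (k + 1) → ℤ) : Fin (k + 1) → ℤ :=
  Fin.cons (y (Fin.last k) + N - y 0) fun a => y a.castSucc - y a.succ

lemma sum_coord (N : ℤ) (y : Fin (k + 1) → ℤ) : ∑ a, coord N y a = N := by
  have h1 := Fin.sum_univ_succ y
  have h2 := Fin.sum_univ_castSucc y
  rw [Fin.sum_univ_succ]
  simp only [coord, Fin.cons_zero, Fin.cons_succ, Finset.sum_sub_distrib]
  linarith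

lemma exists_coord_pos {N : ℤ} (hN : 0 < N) (y : Fin (k + 1) → ℤ) : ∃ a, 0 < coord N y a := by
  by_contra! h
  have := Finset.sum_nonpos fun a (_ : a ∈ Finset.univ) => h a
  rw [sum_coord] at this
  omega

/-- A lattice point with nonnegative coordinates is antitone. -/
lemma antitone_of_coord_nonneg {N : ℤ} {y : Fin (k + 1) → ℤ} (h : 0 ≤ coord N y) :
    Antitone y := by
  rw [Fin.antitone_iff_succ_le]
  intro a
  have := h a.succ
  simp only [coord, Fin.cons_succ, Pi.zero_apply] at this
  omega

namespace IsAlcove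

variable {y : ℤ → Fin (k + 1) → ℤ}

lemma le_add_one (hy : IsAlcove y) {s t : ℤ} (h : t ≤ s + (k + 1)) (a : Fin (k + 1)) :
    y t a ≤ y s a + 1 := by
  have h1 := hy.mono h a
  rw [hy.periodic] at h1
  exact h1

lemma abs_coord_sub_le (hy : IsAlcove y) (N : ℤ) (i j a : Fin (k + 1)) :
    |coord N (y i) a - coord N (y j) a| ≤ 1 := by
  wlog hij : i ≤ j generalizing i j
  · rw [abs_sub_comm]
    exact this j i (le_of_not_ge hij)
  have h1 : ∀ b, y i b ≤ y j b := fun b => hy.mono (by exact_mod_cast hij) b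
  have h2 : ∀ b, y j b ≤ y i b + 1 := hy.le_add_one (by have := i.2; have := j.2; omega)
  rw [abs_le]
  refine Fin.cases ?_ (fun a => ?_) a
  · simp only [coord, Fin.cons_zero]
    have := h1 0; have := h2 0; have := h1 (Fin.last k); have := h2 (Fin.last k)
    omega
  · simp only [coord, Fin.cons_succ]
    have := h1 a.castSucc; have := h2 a.castSucc; have := h1 a.succ; have := h2 a.succ
    omega

lemma ext_of_vertices {z : ℤ → Fin (k + 1) → ℤ} (hy : IsAlcove y) (hz : IsAlcove z)
    (h : ∀ i : Fin (k + 1), y i = z i) : y = z := by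
  have hper : ∀ {w : ℤ → Fin (k + 1) → ℤ}, IsAlcove w → ∀ (s m : ℤ),
      w (s + m * (k + 1)) = w s + fun _ => m := by
    intro w hw s m
    induction m using Int.induction_on with
    | zero => ext a; simp
    | succ m ih =>
      have := hw.periodic (s + m * (k + 1))
      rw [show s + (m + 1 : ℤ) * (k + 1) = s + m * (k + 1) + (k + 1) by ring, this, ih]
      ext a; simp [add_assoc]
    | pred m ih =>
      have := hw.periodic (s + (-m - 1 : ℤ) * (k + 1))
      rw [show s + (-m - 1 : ℤ) * (k + 1) + (k + 1) = s + -m * (k + 1) by ring, ih] at this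
      ext a
      have := congrFun this a
      simp only [Pi.add_apply, Pi.one_apply] at this ⊢
      omega
  funext s
  have hpos : (0 : ℤ) < k + 1 := by positivity
  have h0 := Int.emod_nonneg s hpos.ne'
  have h1 := Int.emod_lt_of_pos s hpos
  have h2 := h ⟨(s % (k + 1)).toNat, by omega⟩
  simp only [Int.toNat_of_nonneg h0] at h2
  rw [← Int.emod_add_ediv_mul s (k + 1), hper hy, hper hz, h2]

end IsAlcove

/-- Only finitely many alcoves have a vertex in the scaled simplex. -/
lemma finite_alcoves (N : ℤ) :
    {y : ℤ → Fin (k + 1) → ℤ | IsAlcove y ∧ ∃ i : Fin (k + 1), 0 ≤ coord N (y i)}.Finite := by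
  refine Set.Finite.of_finite_image (f := fun y (i : Fin (k + 1)) => y i) ?_ ?_
  · refine (Set.finite_Icc (fun _ _ => -N - 1) (fun _ _ => N + 1)).subset ?_
    rintro _ ⟨y, ⟨hy, i, hi⟩, rfl⟩
    have hanti := antitone_of_coord_nonneg hi
    have hsum := hy.sum_eq i
    have hi' := i.2
    have h0 := hi 0
    simp only [coord, Fin.cons_zero, Pi.zero_apply] at h0
    have hfirst : 0 ≤ y i 0 := by
      by_contra! hneg
      have := Finset.sum_lt_sum_of_nonempty (s := Finset.univ) (f := y i) (g := fun _ => 0)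
        Finset.univ_nonempty fun a _ => (hanti (Fin.zero_le a)).trans_lt hneg
      simp at this
      omega
    have hlast : y i (Fin.last k) ≤ 0 := by
      by_contra! hpos
      have := Finset.sum_le_sum (s := Finset.univ) (f := fun _ => 1) (g := y i)
        fun a _ => Int.add_one_le_of_lt (hpos.trans_le (hanti (Fin.le_last a)))
      simp at this
      omega
    have hbd : ∀ (j a : Fin (k + 1)), -N - 1 ≤ y j a ∧ y j a ≤ N + 1 := by
      intro j a
      have h1 := hy.le_add_one (s := i) (t := j) (by have := j.2; omega) a
      have h2 := hy.le_add_one (s := j) (t := i) (by omega) a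
      have h3 := hanti (Fin.zero_le a)
      have h4 := hanti (Fin.le_last a)
      omega
    exact ⟨fun j a => (hbd j a).1, fun j a => (hbd j a).2⟩
  · intro y hy z hz h
    exact hy.1.ext_of_vertices hz.1 fun i => congrFun h i

/-- Reflect an alcove across the facet opposite to its `t`-th vertex. -/
def pivot (t : Fin (k + 1)) (y : ℤ → Fin (k + 1) → ℤ) : ℤ → Fin (k + 1) → ℤ := fun s =>
  if (k + 1 : ℤ) ∣ s - t then y (s - 1) + y (s + 1) - y s else y s

lemma pivot_vertex_of_ne {t s : Fin (k + 1)} (h : s ≠ t) (y : ℤ → Fin (k + 1) → ℤ) :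
    pivot t y s = y s := by
  rw [pivot, if_neg]
  intro hd
  have h1 := s.2
  have h2 := t.2
  have := Int.eq_zero_of_abs_lt_dvd hd (by rw [abs_lt]; omega)
  exact h (Fin.ext (by omega))

lemma not_dvd_add_one (hk : k ≠ 0) {m : ℤ} (h : (k + 1 : ℤ) ∣ m) : ¬ (k + 1 : ℤ) ∣ m + 1 := by
  intro h'
  have := (Int.dvd_add_right h).mp h'
  have := Int.le_of_dvd one_pos this
  omega

lemma not_dvd_sub_one (hk : k ≠ 0) {m : ℤ} (h : (k + 1 : ℤ) ∣ m) : ¬ (k + 1 : ℤ) ∣ m - 1 := by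
  intro h'
  exact not_dvd_add_one hk h' (by simpa using h)

lemma pivot_pivot (hk : k ≠ 0) (t : Fin (k + 1)) (y : ℤ → Fin (k + 1) → ℤ) :
    pivot t (pivot t y) = y := by
  funext s
  by_cases h : (k + 1 : ℤ) ∣ s - t
  · have h1 : ¬ (k + 1 : ℤ) ∣ s - 1 - t := by
      rw [sub_right_comm]; exact not_dvd_sub_one hk h
    have h2 : ¬ (k + 1 : ℤ) ∣ s + 1 - t := by
      rw [add_sub_right_comm]; exact not_dvd_add_one hk h
    simp only [pivot, if_pos h, if_neg h1, if_neg h2]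
    abel
  · simp only [pivot, if_neg h]

lemma IsAlcove.pivot (hk : k ≠ 0) (t : Fin (k + 1)) {y : ℤ → Fin (k + 1) → ℤ}
    (hy : IsAlcove y) : IsAlcove (pivot t y) := by
  refine ⟨monotone_int_of_le_succ fun s => ?_, fun s => ?_, fun s => ?_⟩
  · by_cases h : (k + 1 : ℤ) ∣ s - t
    · have h2 : ¬ (k + 1 : ℤ) ∣ s + 1 - t := by
        rw [add_sub_right_comm]; exact not_dvd_add_one hk h
      simp only [ColorfulKKM.pivot, if_pos h, if_neg h2]
      intro a
      have h3 : y (s - 1) a ≤ y s a := hy.mono (by omega) a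
      simp only [Pi.add_apply, Pi.sub_apply]
      omega
    · by_cases h2 : (k + 1 : ℤ) ∣ s + 1 - t
      · simp only [ColorfulKKM.pivot, if_neg h, if_pos h2]
        intro a
        have h3 : y (s + 1) a ≤ y (s + 1 + 1) a := hy.mono (by omega) a
        simp only [Pi.add_apply, Pi.sub_apply, add_sub_cancel_right]
        omega
      · simp only [ColorfulKKM.pivot, if_neg h, if_neg h2]
        exact hy.mono (by omega)
  · have e : (k + 1 : ℤ) ∣ s + (k + 1) - t ↔ (k + 1 : ℤ) ∣ s - t := by
      rw [add_sub_right_comm]; exact dvd_add_self_right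
    simp only [ColorfulKKM.pivot, e, add_sub_right_comm s (k + 1 : ℤ) 1,
      add_right_comm s (k + 1 : ℤ) 1, hy.periodic]
    split_ifs
    · abel
    · rfl
  · simp only [ColorfulKKM.pivot]
    split_ifs
    · simp only [Pi.add_apply, Pi.sub_apply, Finset.sum_sub_distrib, Finset.sum_add_distrib,
        hy.sum_eq]
      ring
    · exact hy.sum_eq s

lemma IsAlcove.pivot_ne (hk : k ≠ 0) (t : Fin (k + 1)) {y : ℤ → Fin (k + 1) → ℤ}
    (hy : IsAlcove y) : ColorfulKKM.pivot t y ≠ y := by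
  intro h
  have h1 := congrFun h t
  simp only [ColorfulKKM.pivot, sub_self, dvd_zero, if_true] at h1
  have h2 : ∃ a, y t a < y (t + 1) a := by
    by_contra! hle
    have := Finset.sum_le_sum fun a (_ : a ∈ Finset.univ) => hle a
    rw [hy.sum_eq, hy.sum_eq] at this
    omega
  obtain ⟨a, ha⟩ := h2
  have h3 := congrFun h1 a
  have h4 := hy.le_add_one (s := t - 1) (t := t + 1) (by omega) a
  simp only [Pi.add_apply, Pi.sub_apply] at h3
  omega

/-- Two labellings that agree outside the scaled simplex have the same number, modulo two, of
fully labelled alcoves. -/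
lemma sum_full_eq (hk : k ≠ 0) (N : ℤ) (L L' : Fin (k + 1) → (Fin (k + 1) → ℤ) → Fin (k + 1))
    (hL : ∀ i y, ¬ 0 ≤ coord N y → L i y = L' i y) (T : Finset (ℤ → Fin (k + 1) → ℤ))
    (hT : ∀ y, y ∈ T ↔ IsAlcove y ∧ ∃ i : Fin (k + 1), 0 ≤ coord N (y i)) :
    (∑ y ∈ T, if Function.Surjective fun i : Fin (k + 1) => L i (y i) then 1 else 0 : ZMod 2) =
      ∑ y ∈ T, if Function.Surjective fun i : Fin (k + 1) => L' i (y i) then 1 else 0 := by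
  classical
  apply CharTwo.add_eq_zero.mp
  set D : (Fin (k + 1) → (Fin (k + 1) → ℤ) → Fin (k + 1)) →
      (ℤ → Fin (k + 1) → ℤ) × Fin (k + 1) → ZMod 2 := fun L p =>
    if ∀ j, j ≠ 0 → ∃ s : Fin (k + 1), s ≠ p.2 ∧ L s (p.1 s) = j then 1 else 0 with hD
  have hDcongr : ∀ (L L' : Fin (k + 1) → (Fin (k + 1) → ℤ) → Fin (k + 1)) y y' t,
      (∀ s : Fin (k + 1), s ≠ t → L s (y s) = L' s (y' s)) → D L (y, t) = D L' (y', t) := by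
    intro L L' y y' t h
    simp only [hD]
    congr 1
    refine propext (forall₂_congr fun j _ => exists_congr fun s => and_congr_right fun hs => ?_)
    rw [h s hs]
  have e : ∀ L : Fin (k + 1) → (Fin (k + 1) → ℤ) → Fin (k + 1),
      (∑ y ∈ T, if Function.Surjective fun i : Fin (k + 1) => L i (y i) then 1 else 0 : ZMod 2) =
        ∑ p ∈ T ×ˢ Finset.univ, D L p := by
    intro L
    rw [Finset.sum_product]
    refine Finset.sum_congr rfl fun y _ => ?_
    have := surjective_parity (fun i : Fin (k + 1) => L i (y i)) 0
    convert this
  rw [e, e, ← Finset.sum_add_distrib,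
    ← Finset.sum_filter_of_ne (p := fun p : (ℤ → Fin (k + 1) → ℤ) × Fin (k + 1) =>
      ∃ s, s ≠ p.2 ∧ 0 ≤ coord N (p.1 s))]
  · refine Finset.sum_involution (fun p _ => (pivot p.2 p.1, p.2)) ?_ ?_ ?_ ?_
    · rintro ⟨y, t⟩ _
      have hd : ∀ L, D L (pivot t y, t) = D L (y, t) := fun L =>
        hDcongr _ _ _ _ _ fun s hs => by rw [pivot_vertex_of_ne hs]
      simp only [hd]
      exact CharTwo.add_self_eq_zero _
    · rintro ⟨y, t⟩ hp - h
      simp only [Finset.mem_filter, Finset.mem_product, hT] at hp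
      exact hp.1.1.1.pivot_ne hk t (congrArg Prod.fst h)
    · rintro ⟨y, t⟩ hp
      simp only [Finset.mem_filter, Finset.mem_product, hT, Finset.mem_univ, and_true] at hp ⊢
      obtain ⟨⟨hy, -⟩, s, hs, h⟩ := hp
      rw [← pivot_vertex_of_ne hs y] at h
      exact ⟨⟨hy.pivot hk t, s, h⟩, s, hs, h⟩
    · rintro ⟨y, t⟩ _
      simp only [pivot_pivot hk]
  · rintro ⟨y, t⟩ _ hne
    by_contra! hcon
    refine hne ?_
    rw [hDcongr L L' y y t fun s hs => hL s _ (hcon s hs)]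
    exact CharTwo.add_self_eq_zero _

/-- In a fully labelled alcove all vertices lie in the scaled simplex. -/
lemma IsAlcove.coord_nonneg_of_full {y : ℤ → Fin (k + 1) → ℤ} (hy : IsAlcove y) {N : ℤ}
    {L : Fin (k + 1) → (Fin (k + 1) → ℤ) → Fin (k + 1)} (hL : ∀ i y, 0 < coord N y (L i y))
    (hfull : Function.Surjective fun i : Fin (k + 1) => L i (y i)) (i : Fin (k + 1)) :
    0 ≤ coord N (y i) := by
  intro a
  obtain ⟨j, hj⟩ := hfull a
  have h1 := hL j (y j)
  simp only at hj
  rw [hj] at h1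
  have h2 := abs_le.mp (hy.abs_coord_sub_le N i j a)
  simp only [Pi.zero_apply]
  omega

lemma sum_staircase (s : ℤ) : ∑ a : Fin (k + 1), (s + a) / (k + 1 : ℤ) = s := by
  have hpos : (0 : ℤ) < k + 1 := by positivity
  have hstep : ∀ s : ℤ, ∑ a : Fin (k + 1), (s + 1 + a) / (k + 1 : ℤ) =
      ∑ a : Fin (k + 1), (s + a) / (k + 1 : ℤ) + 1 := by
    intro s
    rw [Fin.sum_univ_castSucc, Fin.sum_univ_succ (fun a : Fin (k + 1) => (s + a) / (k + 1 : ℤ))]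
    have h1 : (s + 1 + (Fin.last k : ℕ)) / (k + 1 : ℤ) = s / (k + 1) + 1 := by
      rw [Fin.val_last, show s + 1 + (k : ℤ) = s + (k + 1) by ring,
        Int.add_ediv_of_dvd_right dvd_rfl, Int.ediv_self hpos.ne']
    rw [h1]
    simp only [Fin.val_castSucc, Fin.val_succ, Fin.val_zero, Nat.cast_zero, add_zero,
      Nat.cast_add, Nat.cast_one]
    have h2 : ∀ x : Fin k, s + 1 + (x : ℤ) = s + (x + 1) := fun x => by ring
    simp only [h2]
    ring
  induction s using Int.induction_on with
  | zero =>
    refine Finset.sum_eq_zero fun a _ => Int.ediv_eq_zero_of_lt (by positivity) ?_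
    have := a.2
    omega
  | succ m ih => rw [hstep, ih]
  | pred m ih =>
    have := hstep (-m - 1)
    rw [sub_add_cancel, ih] at this
    omega

/-- The alcove whose `s`-th vertex is the indicator of `{a | a < s}`. -/
def staircase (k : ℕ) (s : ℤ) (a : Fin (k + 1)) : ℤ := (s + (Fin.rev a : ℕ)) / (k + 1 : ℤ)

lemma isAlcove_staircase : IsAlcove (staircase k) := by
  have hpos : (0 : ℤ) < k + 1 := by positivity
  refine ⟨fun s t h a => Int.ediv_le_ediv hpos (by omega), fun s => ?_, fun s => ?_⟩
  · ext a
    simp only [staircase, Pi.add_apply, Pi.one_apply]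
    rw [add_right_comm, Int.add_ediv_of_dvd_right dvd_rfl, Int.ediv_self hpos.ne']
  · exact (Equiv.sum_comp Fin.revPerm fun a : Fin (k + 1) => (s + (a : ℕ)) / (k + 1 : ℤ)).trans
      (sum_staircase s)

lemma staircase_vertex (i a : Fin (k + 1)) : staircase k i a = if a < i then 1 else 0 := by
  have hpos : (0 : ℤ) < k + 1 := by positivity
  have h1 := i.2
  have h2 := a.2
  have h3 : ((Fin.rev a : ℕ) : ℤ) = k - a := by rw [Fin.val_rev]; omega
  rw [staircase, h3]
  split_ifs with h
  · rw [Fin.lt_def] at h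
    rw [Int.ediv_eq_iff_of_pos hpos]
    constructor <;> linarith
  · rw [Fin.lt_def] at h
    exact Int.ediv_eq_zero_of_lt (by omega) (by omega)

/-- The greatest index of a positive coordinate. -/
noncomputable def topLabel {N : ℤ} (hN : 0 < N) (y : Fin (k + 1) → ℤ) : Fin (k + 1) :=
  (Finset.univ.filter fun a => 0 < coord N y a).max' <| by
    obtain ⟨a, ha⟩ := exists_coord_pos hN y
    exact ⟨a, by simpa using ha⟩

lemma coord_topLabel_pos {N : ℤ} (hN : 0 < N) (y : Fin (k + 1) → ℤ) :
    0 < coord N y (topLabel hN y) := by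
  have := Finset.max'_mem (Finset.univ.filter fun a => 0 < coord N y a) (by
    obtain ⟨a, ha⟩ := exists_coord_pos hN y
    exact ⟨a, by simpa using ha⟩)
  exact (Finset.mem_filter.mp this).2

lemma le_topLabel {N : ℤ} (hN : 0 < N) {y : Fin (k + 1) → ℤ} {a : Fin (k + 1)}
    (h : 0 < coord N y a) : a ≤ topLabel hN y :=
  Finset.le_max' _ _ (by simpa using h)

lemma topLabel_staircase {N : ℤ} (hN : 0 < N) (i : Fin (k + 1)) :
    topLabel hN (staircase k i) = i := by
  apply le_antisymm
  · have h := coord_topLabel_pos hN (staircase k i)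
    generalize topLabel hN (staircase k i) = b at h
    induction b using Fin.cases with
    | zero => exact Fin.zero_le i
    | succ b =>
      simp only [coord, Fin.cons_succ, staircase_vertex] at h
      by_contra hlt
      rw [if_neg, if_neg] at h
      · omega
      · exact fun h' => hlt h'.le
      · intro h'
        rw [Fin.lt_def] at h'
        rw [Fin.le_def, Fin.val_succ] at hlt
        simp at h'
        omega
  · apply le_topLabel
    induction i using Fin.cases with
    | zero =>
      simp only [coord, Fin.cons_zero, staircase_vertex]
      simpa using hN
    | succ i =>
      simp only [coord, Fin.cons_succ, staircase_vertex]
      simp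

/-- The staircase is the only alcove fully labelled by `topLabel`. -/
lemma IsAlcove.eq_staircase {y : ℤ → Fin (k + 1) → ℤ} (hy : IsAlcove y) {N : ℤ} (hN : 0 < N)
    (hfull : Function.Surjective fun i : Fin (k + 1) => topLabel hN (y i)) :
    y = staircase k := by
  have hnn := hy.coord_nonneg_of_full (L := fun _ => topLabel hN)
    (fun _ => coord_topLabel_pos hN) hfull
  have hanti := fun i => antitone_of_coord_nonneg (hnn i)
  have hzero : y 0 = 0 := by
    obtain ⟨m, hm⟩ := hfull 0
    have hconst : ∀ a, y m a = y m 0 := by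
      intro a
      induction a using Fin.induction with
      | zero => rfl
      | succ a ih =>
        have h1 := hnn m a.succ
        have h2 : ¬ 0 < coord N (y m) a.succ := fun h => by
          have := le_topLabel hN h
          simp only at hm
          rw [hm] at this
          exact absurd this (by simp)
        simp only [coord, Fin.cons_succ, Pi.zero_apply] at h1 h2
        omega
    have hsum := hy.sum_eq m
    simp only [hconst, Finset.sum_const, Finset.card_univ, Fintype.card_fin, nsmul_eq_mul,
      Nat.cast_add, Nat.cast_one] at hsum
    have hd : (k + 1 : ℤ) ∣ m := ⟨_, hsum.symm⟩
    have hm0 : (m : ℤ) = 0 :=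
      Int.eq_zero_of_abs_lt_dvd hd (by have := m.2; rw [abs_lt]; omega)
    rw [hm0] at hsum hconst
    have : y 0 0 = 0 := by
      rcases mul_eq_zero.mp hsum with h | h
      · omega
      · exact h
    ext a
    rw [hconst, this, Pi.zero_apply]
  refine hy.ext_of_vertices isAlcove_staircase fun i => ?_
  have hle : ∀ a, 0 ≤ y i a ∧ y i a ≤ 1 := by
    intro a
    have h1 := hy.mono (show (0 : ℤ) ≤ i by positivity) a
    have h2 := hy.le_add_one (s := 0) (t := i) (by have := i.2; omega) a
    rw [hzero] at h1 h2
    simpa using And.intro h1 h2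
  have hsum := hy.sum_eq i
  ext a
  rw [staircase_vertex]
  split_ifs with h
  · by_contra hne
    have h0 : y i a = 0 := by have := hle a; omega
    have : ∑ b, y i b ≤ ∑ b, if b < a then 1 else 0 := by
      refine Finset.sum_le_sum fun b _ => ?_
      split_ifs with hb
      · exact (hle b).2
      · exact (hanti i (not_lt.mp hb)).trans h0.le
    rw [hsum, Finset.sum_boole] at this
    simp only [Finset.filter_gt_eq_Iio, Fin.card_Iio] at this
    rw [Fin.lt_def] at h
    omega
  · by_contra hne
    have h0 : y i a = 1 := by have := hle a; omega
    have : (∑ b, if b ≤ a then 1 else 0) ≤ ∑ b, y i b := by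
      refine Finset.sum_le_sum fun b _ => ?_
      split_ifs with hb
      · exact h0.ge.trans (hanti i hb)
      · exact (hle b).1
    rw [hsum, Finset.sum_boole] at this
    simp only [Finset.filter_ge_eq_Iic, Fin.card_Iic] at this
    rw [Fin.lt_def] at h
    push_cast at this
    omega

/-- A colorful Sperner lemma for the Freudenthal triangulation: if the `i`-th labelling always picks
a positive coordinate inside the scaled simplex, then some alcove in the simplex receives
pairwise distinct labels when its `i`-th vertex is labelled by the `i`-th labelling. -/
theorem exists_full_alcove (hk : k ≠ 0) {N : ℤ} (hN : 0 < N)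
    (L : Fin (k + 1) → (Fin (k + 1) → ℤ) → Fin (k + 1))
    (hL : ∀ i y, 0 ≤ coord N y → 0 < coord N y (L i y)) :
    ∃ y : ℤ → Fin (k + 1) → ℤ, IsAlcove y ∧ (∀ i : Fin (k + 1), 0 ≤ coord N (y i)) ∧
      Function.Bijective fun i : Fin (k + 1) => L i (y i) := by
  classical
  let M : Fin (k + 1) → (Fin (k + 1) → ℤ) → Fin (k + 1) := fun i y =>
    if 0 ≤ coord N y then L i y else topLabel hN y
  have hM : ∀ i y, 0 < coord N y (M i y) := by
    intro i y
    simp only [M]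
    split_ifs with h
    · exact hL i y h
    · exact coord_topLabel_pos hN y
  let T := (finite_alcoves (k := k) N).toFinset
  have hT : ∀ y, y ∈ T ↔ IsAlcove y ∧ ∃ i : Fin (k + 1), 0 ≤ coord N (y i) := by
    intro y; simp [T]
  have hstair : Function.Surjective fun i : Fin (k + 1) => topLabel hN (staircase k i) := by
    intro i
    exact ⟨i, topLabel_staircase hN i⟩
  have hparity := sum_full_eq hk N M (fun _ => topLabel hN)
    (fun i y h => by simp only [M, if_neg h]) T hT
  rw [Finset.sum_eq_single (f := fun y : ℤ → Fin (k + 1) → ℤ =>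
    if Function.Surjective fun i : Fin (k + 1) => topLabel hN (y i) then (1 : ZMod 2) else 0)
    (staircase k)] at hparity
  · rw [if_pos hstair] at hparity
    obtain ⟨y, hyT, hy⟩ := Finset.exists_ne_zero_of_sum_ne_zero (hparity.trans_ne one_ne_zero)
    have hfull : Function.Surjective fun i : Fin (k + 1) => M i (y i) := by
      by_contra h
      exact hy (if_neg h)
    have hya := ((hT y).mp hyT).1
    have hnn := hya.coord_nonneg_of_full hM hfull
    refine ⟨y, hya, hnn, Finite.injective_iff_bijective.mp ?_⟩
    have : (fun i : Fin (k + 1) => M i (y i)) = fun i : Fin (k + 1) => L i (y i) := by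
      funext i
      simp only [M, if_pos (hnn i)]
    rw [this] at hfull
    exact Finite.injective_iff_surjective.mpr hfull
  · intro y hyT hne
    rw [if_neg]
    exact fun h => hne (((hT y).mp hyT).1.eq_staircase hN h)
  · intro h
    refine absurd ((hT _).mpr ⟨isAlcove_staircase, 0, ?_⟩) h
    exact isAlcove_staircase.coord_nonneg_of_full (L := fun _ => topLabel hN)
      (fun _ => coord_topLabel_pos hN) hstair 0

/-- At every scale there is a permutation `π` and points of the sets `A i (π i)` which are close
to each other. -/
lemma exists_perm_near (hk : k ≠ 0) (A : Fin (k + 1) → Fin (k + 1) → Set (Fin (k + 1) → ℝ))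
    (hcover : ∀ i, ∀ S : Finset (Fin (k + 1)), S.Nonempty →
      {x ∈ stdSimplex ℝ (Fin (k + 1)) | ∀ j ∉ S, x j = 0} ⊆ ⋃ j ∈ S, A i j) (m : ℕ) :
    ∃ (π : Equiv.Perm (Fin (k + 1))) (p : Fin (k + 1) → Fin (k + 1) → ℝ),
      (∀ i, p i ∈ A i (π i)) ∧ (∀ i, p i ∈ stdSimplex ℝ (Fin (k + 1))) ∧
      ∀ i, dist (p i) (p 0) ≤ 1 / ((m : ℝ) + 1) := by
  classical
  set N : ℤ := m + 1 with hNdef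
  have hN : 0 < N := by positivity
  have hNR : (0 : ℝ) < N := by exact_mod_cast hN
  let q : (Fin (k + 1) → ℤ) → Fin (k + 1) → ℝ := fun y a => (coord N y a : ℝ) / N
  have hq : ∀ y, 0 ≤ coord N y → q y ∈ stdSimplex ℝ (Fin (k + 1)) := by
    intro y hy
    refine ⟨fun a => div_nonneg (by exact_mod_cast hy a) hNR.le, ?_⟩
    simp only [q]
    rw [← Finset.sum_div, ← Int.cast_sum, sum_coord, div_self hNR.ne']
  have hex : ∀ i y, ∃ j, 0 ≤ coord N y → 0 < coord N y j ∧ q y ∈ A i j := by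
    intro i y
    by_cases hy : 0 ≤ coord N y
    · obtain ⟨a, ha⟩ := exists_coord_pos hN y
      have hmem := hcover i (Finset.univ.filter fun j => 0 < coord N y j) ⟨a, by simpa using ha⟩
        (show q y ∈ _ from ⟨hq y hy, fun j hj => ?_⟩)
      · simp only [Set.mem_iUnion, Finset.mem_filter, Finset.mem_univ, true_and,
          exists_prop] at hmem
        obtain ⟨j, hj⟩ := hmem
        exact ⟨j, fun _ => hj⟩
      · have h1 := hy j
        simp only [Finset.mem_filter, Finset.mem_univ, true_and, not_lt] at hj
        have h2 : coord N y j = 0 := le_antisymm hj h1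
        simp [q, h2]
    · exact ⟨0, fun h => absurd h hy⟩
  choose L hL using hex
  obtain ⟨y, hya, hnn, hbij⟩ := exists_full_alcove hk hN L fun i y h => (hL i y h).1
  refine ⟨Equiv.ofBijective _ hbij, fun i => q (y i), fun i => (hL i _ (hnn i)).2,
    fun i => hq _ (hnn i), fun i => ?_⟩
  rw [dist_pi_le_iff (by positivity)]
  intro a
  have h1 := hya.abs_coord_sub_le N i 0 a
  have h2 : (m : ℝ) + 1 = N := by rw [hNdef]; push_cast; rfl
  rw [Real.dist_eq]
  simp only [q]
  rw [← sub_div, abs_div, abs_of_pos hNR, h2]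
  gcongr
  exact_mod_cast h1

end ColorfulKKM

open Filter Topology in
/-- **Gale's colorful KKM theorem.** Given `k+1` KKM covers `A i 1, …, A i (k+1)`
(for `i ∈ [k+1]`) of the standard `k`-simplex by closed sets, there is a permutation `π`
of `[k+1]` such that `⋂ i, A i (π i) ≠ ∅`. -/
theorem colorful_KKM (k : ℕ) (A : Fin (k + 1) → Fin (k + 1) → Set (Fin (k + 1) → ℝ))
    (hclosed : ∀ i j, IsClosed (A i j))
    (hsub : ∀ i j, A i j ⊆ stdSimplex ℝ (Fin (k + 1)))
    (hcover : ∀ i, ∀ S : Finset (Fin (k + 1)), S.Nonempty →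
      {x ∈ stdSimplex ℝ (Fin (k + 1)) | ∀ j ∉ S, x j = 0} ⊆ ⋃ j ∈ S, A i j) :
    ∃ π : Equiv.Perm (Fin (k + 1)), (⋂ i, A i (π i)).Nonempty := by
  by_cases hk : k = 0
  · subst hk
    have : Subsingleton (Fin (0 + 1)) := Fin.subsingleton_one
    have h := hcover 0 {0} (Finset.singleton_nonempty 0)
      (show Pi.single 0 1 ∈ _ from
        ⟨single_mem_stdSimplex ℝ 0, fun j hj => absurd (Subsingleton.elim j 0) (by simpa using hj)⟩)
    refine ⟨1, Pi.single 0 1, ?_⟩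
    rw [Set.mem_iInter]
    intro i
    rw [Subsingleton.elim i 0]
    simpa using h
  choose π p hpA hpS hpd using ColorfulKKM.exists_perm_near hk A hcover
  obtain ⟨σ, hσ⟩ : ∃ σ, ∀ᶠ m in (hyperfilter ℕ : Filter ℕ), π m = σ := by
    rw [← Ultrafilter.eventually_exists_iff]
    exact Eventually.of_forall fun m => ⟨π m, rfl⟩
  obtain ⟨x, -, hx⟩ := (isCompact_stdSimplex ℝ (Fin (k + 1))).ultrafilter_le_nhds'
    ((hyperfilter ℕ).map fun m => p m 0) (mem_map.mpr (Eventually.of_forall fun m => hpS m 0))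
  have hx0 : Tendsto (fun m => p m 0) (hyperfilter ℕ) (𝓝 x) := hx
  refine ⟨σ, x, Set.mem_iInter.mpr fun i => ?_⟩
  have hle : (hyperfilter ℕ : Filter ℕ) ≤ atTop := Nat.hyperfilter_le_atTop
  have hdist : Tendsto (fun m => dist (p m i) (p m 0)) (hyperfilter ℕ) (𝓝 0) :=
    squeeze_zero (fun _ => dist_nonneg) (fun m => hpd m i)
      (tendsto_one_div_add_atTop_nhds_zero_nat.mono_left hle)
  have hxi : Tendsto (fun m => p m i) (hyperfilter ℕ) (𝓝 x) := by
    rw [tendsto_iff_dist_tendsto_zero] at hx0 ⊢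
    refine squeeze_zero (fun _ => dist_nonneg) (fun m => dist_triangle _ (p m 0) _) ?_
    simpa using hdist.add hx0
  refine (hclosed i (σ i)).mem_of_tendsto hxi (hσ.mono fun m hm => ?_)
  rw [← hm]
  exact hpA m i
end
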